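/- (Rational Parameter Theorem for geometric constructibility.) Let I ⊆ ℝ be a nonempty open interval, let a₁, …, aₘ be real numbers, let K = ℚ(a₁,…,aₘ), and let u : I → ℝ be a continuous function. Assume there exists a nonzero polynomial W ∈ K[x,y] such that W(x, u(x)) = 0 for all x ∈ I. If there exists c ∈ I transcendental over K such that u(c) ∉ Qclo(ℚ(a₁,…,aₘ,c)), then there exists a rational number c' ∈ I such that u(c') ∉ Qclo(ℚ(a₁,…,aₘ,c')). -/

import Mathlib

/-- The real quadratic closure of a subfield `K` of `ℝ`: the smallest subfield of `ℝ`
containing `K` that is closed under real square roots. -/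
noncomputable def Qclo (K : Subfield ℝ) : Subfield ℝ :=
  sInf {M : Subfield ℝ | K ≤ M ∧ ∀ c : ℝ, c ∈ M → 0 ≤ c → Real.sqrt c ∈ M}

/-- `c` is transcendental over the subfield `K` of `ℝ`: it is a root of no nonzero
polynomial with coefficients in `K`. -/
def TranscOver (K : Subfield ℝ) (c : ℝ) : Prop :=
  ∀ p : Polynomial ℝ, (∀ i, p.coeff i ∈ K) → Polynomial.eval c p = 0 → p = 0

open Polynomial in
/-- Newton iteration: an approximate simple root modulo an ideal lifts to a root modulo
every power of that ideal. -/
theorem exists_sub_mem_eval_mem_pow {R : Type*} [CommRing R] (I : Ideal R) (f : R[X]) (y e : R)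
    (h0 : f.eval y ∈ I) (h1 : e * f.derivative.eval y - 1 ∈ I) (k : ℕ) :
    ∃ Y, Y - y ∈ I ∧ f.eval Y ∈ I ^ (k + 1) := by
  induction k with
  | zero => exact ⟨y, by simp, by simpa using h0⟩
  | succ k ih =>
    obtain ⟨Y, hY, hf⟩ := ih
    have hfI : f.eval Y ∈ I := Ideal.pow_le_self (by omega) hf
    refine ⟨Y + -(e * f.eval Y), ?_, ?_⟩
    · have : Y + -(e * f.eval Y) - y = (Y - y) - e * f.eval Y := by ring
      rw [this]
      exact sub_mem hY (Ideal.mul_mem_left _ _ hfI)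
    · obtain ⟨c, hc⟩ := f.binomExpansion Y (-(e * f.eval Y))
      have hd : e * f.derivative.eval Y - 1 ∈ I := by
        have h2 : f.derivative.eval Y - f.derivative.eval y ∈ I :=
          I.mem_of_dvd (sub_dvd_eval_sub Y y f.derivative) hY
        have : e * f.derivative.eval Y - 1
            = e * (f.derivative.eval Y - f.derivative.eval y)
              + (e * f.derivative.eval y - 1) := by ring
        rw [this]
        exact add_mem (Ideal.mul_mem_left _ _ h2) h1
      have : f.eval (Y + -(e * f.eval Y)) =
          -((e * f.derivative.eval Y - 1) * f.eval Y)
            + c * e ^ 2 * (f.eval Y * f.eval Y) := by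
        rw [hc]; ring
      rw [this, pow_succ']
      refine add_mem (neg_mem (Ideal.mul_mem_mul hd hf)) (Ideal.mul_mem_left _ _ ?_)
      exact Ideal.mul_mem_mul hfI hf

open Polynomial in
/-- A monic complex polynomial has a root whose distance to `z` is controlled by its value
at `z`. -/
theorem exists_isRoot_norm_sub_pow_le {F : ℂ[X]} (hF : F.Monic) (hd : 1 ≤ F.natDegree) (z : ℂ) :
    ∃ ρ, F.IsRoot ρ ∧ ‖z - ρ‖ ^ F.natDegree ≤ ‖F.eval z‖ := by
  have hs := IsAlgClosed.splits F
  have hcard : F.roots.card = F.natDegree := hs.natDegree_eq_card_roots.symm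
  have hne : F.roots.toFinset.Nonempty := by
    rw [Multiset.toFinset_nonempty]
    intro h
    rw [h] at hcard
    simp at hcard
    omega
  obtain ⟨ρ, hρ, hmin⟩ := F.roots.toFinset.exists_min_image (fun r => ‖z - r‖) hne
  refine ⟨ρ, ?_, ?_⟩
  · simpa [hF.ne_zero] using hρ
  · have hev : F.eval z = (F.roots.map fun r => z - r).prod := by
      conv_lhs => rw [hs.eq_prod_roots_of_monic hF]
      simp [eval_multiset_prod, Multiset.map_map]
    rw [hev, ← hcard]
    have key : ∀ s : Multiset ℂ, (∀ r ∈ s, ‖z - ρ‖ ≤ ‖z - r‖) →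
        ‖z - ρ‖ ^ s.card ≤ ‖(s.map fun r => z - r).prod‖ := by
      intro s
      induction s using Multiset.induction_on with
      | empty => simp
      | cons a s ih =>
        intro h
        rw [Multiset.card_cons, Multiset.map_cons, Multiset.prod_cons, norm_mul, pow_succ']
        exact mul_le_mul (h a (by simp)) (ih fun r hr => h r (by simp [hr])) (by positivity)
          (norm_nonneg _)
    exact key _ fun r hr => hmin r (by simpa using hr)

open Polynomial in
/-- A monic factorization of a product of distinct linear factors is given by a subset of
the factors. -/
theorem exists_finset_eq_prod_X_sub_C {F J : Type*} [Field F] [Fintype J] [DecidableEq J]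
    (ρ : J → F) {g g' : F[X]} (hg : g.Monic) (hg' : g'.Monic)
    (h : g * g' = ∏ j, (X - C (ρ j))) :
    ∃ S : Finset J, g = ∏ j ∈ S, (X - C (ρ j)) ∧ g' = ∏ j ∈ Sᶜ, (X - C (ρ j)) := by
  obtain ⟨t, u, b, c, htu, hdis, hbc, hx, hy⟩ :=
    mul_eq_mul_prime_prod (fun i _ => prime_X_sub_C (ρ i)) (h.trans (one_mul _).symm)
  have hu : u = tᶜ := by
    rw [eq_compl_iff_isCompl, isCompl_comm]
    exact ⟨hdis, codisjoint_iff.mpr htu⟩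
  subst hu
  have h1 : ∀ (s : Finset J) (b p : F[X]), IsUnit b → p.Monic →
      p = b * ∏ j ∈ s, (X - C (ρ j)) → b = 1 := by
    intro s b p hb hp hpb
    have hm : (∏ j ∈ s, (X - C (ρ j))).Monic := monic_prod_of_monic _ _ fun j _ => monic_X_sub_C _
    have : b.Monic := by
      rw [hpb] at hp
      exact hm.of_mul_monic_right hp
    exact this.eq_one_of_isUnit hb
  have hb := h1 _ _ _ (IsUnit.of_mul_eq_one _ hbc.symm) hg hx
  have hc := h1 _ _ _ (IsUnit.of_mul_eq_one _ ((mul_comm _ _).trans hbc.symm)) hg' hy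
  exact ⟨t, by simpa [hb] using hx, by simpa [hc] using hy⟩

open Polynomial Filter Topology in
/-- If linear factors converge to each other at a given rate, so do the coefficients of
their products. -/
theorem tendsto_coeff_prod_X_sub_C {J : Type*} [DecidableEq J] (l : Filter ℕ) (s : ℕ → ℂ)
    (ρ y : J → ℕ → ℂ) (r : J → ℂ) (hρ : ∀ j, Tendsto (ρ j) l (𝓝 (r j)))
    (hy : ∀ j, Tendsto (y j) l (𝓝 (r j)))
    (hs : ∀ j, Tendsto (fun M => s M * (ρ j M - y j M)) l (𝓝 0)) (S : Finset J) :
    ∀ k, Tendsto (fun M => s M * ((∏ j ∈ S, (X - C (ρ j M))).coeff k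
      - (∏ j ∈ S, (X - C (y j M))).coeff k)) l (𝓝 0) := by
  have hlim : ∀ (z : J → ℕ → ℂ), (∀ j, Tendsto (z j) l (𝓝 (r j))) → ∀ (S : Finset J) k,
      Tendsto (fun M => (∏ j ∈ S, (X - C (z j M))).coeff k) l
        (𝓝 ((∏ j ∈ S, (X - C (r j))).coeff k)) := by
    intro z hz S
    induction S using Finset.induction_on with
    | empty => intro k; simpa using tendsto_const_nhds
    | insert a S ha ih =>
      intro k
      simp only [Finset.prod_insert ha, sub_mul, coeff_sub, coeff_C_mul]
      refine Tendsto.sub ?_ ((hz a).mul (ih k))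
      cases k with
      | zero => simpa using tendsto_const_nhds
      | succ k => simpa [coeff_X_mul] using ih k
  induction S using Finset.induction_on with
  | empty => intro k; simpa using tendsto_const_nhds
  | insert a S ha ih =>
    intro k
    simp only [Finset.prod_insert ha, sub_mul, coeff_sub, coeff_C_mul]
    have h1 := (hlim ρ hρ S k).mul (hs a)
    have h2 := (hy a).mul (ih k)
    have h3 : Tendsto (fun M => s M * ((X * ∏ j ∈ S, (X - C (ρ j M))).coeff k
        - (X * ∏ j ∈ S, (X - C (y j M))).coeff k)) l (𝓝 0) := by
      cases k with
      | zero => simpa using tendsto_const_nhds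
      | succ k => simpa [coeff_X_mul] using ih k
    have := h3.sub (h1.add h2)
    simp only [mul_zero, add_zero, sub_zero] at this
    refine this.congr fun M => ?_
    ring

open MvPolynomial in
/-- Denominators of the values of a rational polynomial at the points `p + τ / M`. -/
theorem exists_denominator {σ : Type*} (p : σ → ℚ) (h : MvPolynomial σ ℚ) :
    ∃ D : ℕ, 0 < D ∧ ∃ e : ℕ, ∀ (M : ℕ) (τ : σ → ℕ), 0 < M →
      ∃ z : ℤ, (D * M ^ e : ℚ) * eval (fun i => p i + τ i / M) h = z := by
  induction h using MvPolynomial.induction_on with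
  | C a =>
    refine ⟨a.den, a.den_pos, 0, fun M τ _ => ⟨a.num, ?_⟩⟩
    simp [mul_comm, Rat.mul_den_eq_num]
  | add f g hf hg =>
    obtain ⟨D, hD, e, hf⟩ := hf
    obtain ⟨D', hD', e', hg⟩ := hg
    refine ⟨D * D', by positivity, e + e', fun M τ hM => ?_⟩
    obtain ⟨z, hz⟩ := hf M τ hM
    obtain ⟨z', hz'⟩ := hg M τ hM
    refine ⟨D' * M ^ e' * z + D * M ^ e * z', ?_⟩
    push_cast
    rw [← hz, ← hz', map_add]
    ring
  | mul_X f i hf =>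
    obtain ⟨D, hD, e, hf⟩ := hf
    refine ⟨D * (p i).den, by have := (p i).den_pos; positivity, e + 1, fun M τ hM => ?_⟩
    obtain ⟨z, hz⟩ := hf M τ hM
    refine ⟨z * ((p i).num * M + (p i).den * τ i), ?_⟩
    have hM' : (M : ℚ) ≠ 0 := by positivity
    have hp : (p i).den * p i = (p i).num := by rw [mul_comm, Rat.mul_den_eq_num]
    push_cast
    rw [← hz, map_mul, eval_X, ← hp]
    generalize eval (fun i => p i + (τ i : ℚ) / M) f = E
    field_simp
    ring

open Polynomial in
/-- Gauss' lemma with denominators: monic rational factors of a monic polynomial whose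
coefficients become integers after multiplication by `s`. -/
theorem exists_int_pow_mul_coeff_of_dvd {f g : ℚ[X]} (hf : f.Monic) (hg : g.Monic) (hgf : g ∣ f)
    (s : ℤ) (hs : ∀ i, ∃ z : ℤ, s * f.coeff i = z) (n : ℕ) (hn : f.natDegree ≤ n) (i : ℕ) :
    ∃ z : ℤ, (s : ℚ) ^ n * g.coeff i = z := by
  have hlift : f.scaleRoots (s : ℚ) ∈ lifts (Int.castRingHom ℚ) := by
    rw [lifts_iff_coeff_lifts]
    intro k
    rw [coeff_scaleRoots]
    rcases lt_trichotomy k f.natDegree with hk | hk | hk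
    · obtain ⟨z, hz⟩ := hs k
      refine ⟨z * s ^ (f.natDegree - k - 1), ?_⟩
      obtain ⟨t, ht⟩ : ∃ t, f.natDegree - k = t + 1 := ⟨f.natDegree - k - 1, by omega⟩
      rw [ht, Nat.add_sub_cancel, pow_succ]
      push_cast [eq_intCast]
      rw [← hz]; ring
    · refine ⟨1, ?_⟩
      subst hk
      simp [hf.coeff_natDegree]
    · exact ⟨0, by simp [coeff_eq_zero_of_natDegree_lt hk]⟩
  obtain ⟨f', hf', -, hmon⟩ := lifts_and_natDegree_eq_and_monic hlift
    ((monic_scaleRoots_iff _).mpr hf)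
  have hdvd : g.scaleRoots (s : ℚ) ∣ f'.map (algebraMap ℤ ℚ) := by
    have := scaleRoots_dvd _ _ (r := (s : ℚ)) hgf
    rwa [← hf'] at this
  obtain ⟨g', hg'⟩ := IsIntegrallyClosed.eq_map_mul_C_of_dvd ℚ hmon hdvd
  rw [((monic_scaleRoots_iff _).mpr hg).leadingCoeff, C_1, mul_one] at hg'
  have hc : g.coeff i * (s : ℚ) ^ (g.natDegree - i) = (g'.coeff i : ℤ) := by
    rw [← coeff_scaleRoots, ← hg', coeff_map]; rfl
  have hle : g.natDegree - i ≤ n := by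
    have := natDegree_le_of_dvd hgf hf.ne_zero
    omega
  refine ⟨g'.coeff i * s ^ (n - (g.natDegree - i)), ?_⟩
  push_cast
  rw [← hc, ← Nat.add_sub_of_le hle, pow_add]
  simp
  ring
open MvPolynomial Filter Topology in
/-- Integer-valued functions on a finite grid that get arbitrarily close to complex
polynomials of degree at most `B` eventually are rational polynomials of degree at most `B`
on the grid. -/
theorem eventually_exists_interpolant {σ ι : Type*} (l : Filter ι) (G : Finset (σ → ℕ)) (B : ℕ)
    (N : ι → (σ → ℕ) → ℤ) (Φ : ι → MvPolynomial σ ℂ) (hΦ : ∀ M, (Φ M).totalDegree ≤ B)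
    (h : ∀ v ∈ G, Tendsto (fun M => (N M v : ℂ) - eval (fun i => (v i : ℂ)) (Φ M)) l (𝓝 0)) :
    ∀ᶠ M in l, ∃ H : MvPolynomial σ ℚ, H.totalDegree ≤ B ∧
      ∀ v ∈ G, eval (fun i => (v i : ℚ)) H = N M v := by
  classical
  let ev : MvPolynomial σ ℚ →ₗ[ℚ] (G → ℚ) :=
    LinearMap.pi fun v => (aeval (fun i => ((v : σ → ℕ) i : ℚ))).toLinearMap
  let E := (restrictTotalDegree σ ℚ B).map ev
  let b := Module.finBasis ℚ ((G → ℚ) ⧸ E)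
  have key : ∀ j, ∀ᶠ M in l, b.coord j (E.mkQ fun v => (N M v : ℚ)) = 0 := by
    intro j
    let L : (G → ℚ) →ₗ[ℚ] ℚ := (b.coord j).comp E.mkQ
    let c : G → ℚ := fun v => L (Pi.single v 1)
    have hL : ∀ x, L x = ∑ v, x v * c v := fun x => by
      rw [LinearMap.pi_apply_eq_sum_univ L x]
      simp only [smul_eq_mul, c]
      refine Finset.sum_congr rfl fun v _ => ?_
      congr 2
      ext w
      simp [Pi.single_apply, eq_comm]
    have hmon : ∀ d : σ →₀ ℕ, (d.sum fun _ e => e) ≤ B →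
        ∑ v : G, (∏ i ∈ d.support, ((v : σ → ℕ) i : ℚ) ^ d i) * c v = 0 := by
      intro d hd
      have hm : ev (monomial d 1) ∈ E := by
        refine Submodule.mem_map_of_mem ?_
        rw [mem_restrictTotalDegree]
        exact (totalDegree_monomial_le d 1).trans hd
      have h0 : L (ev (monomial d 1)) = 0 := by
        simp only [L, LinearMap.comp_apply, Submodule.mkQ_apply]
        rw [(Submodule.Quotient.mk_eq_zero E).mpr hm, map_zero]
      rw [hL] at h0
      rw [← h0]
      refine Finset.sum_congr rfl fun v _ => ?_
      simp [ev, aeval_monomial, Finsupp.prod]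
    have hkill : ∀ M, ∑ v : G, eval (fun i => ((v : σ → ℕ) i : ℂ)) (Φ M) * (c v : ℂ) = 0 := by
      intro M
      simp_rw [eval_eq, Finset.sum_mul]
      rw [Finset.sum_comm]
      refine Finset.sum_eq_zero fun d hd => ?_
      have := hmon d ((le_totalDegree hd).trans (hΦ M))
      have h2 : ((∑ v : G, (∏ i ∈ d.support, ((v : σ → ℕ) i : ℚ) ^ d i) * c v : ℚ) : ℂ) = 0 := by
        rw [this]; simp
      push_cast at h2
      simp_rw [mul_assoc]
      rw [← Finset.mul_sum, h2, mul_zero]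
    let D : ℤ := ∏ v : G, ((c v).den : ℤ)
    have hD : D ≠ 0 := Finset.prod_ne_zero_iff.mpr fun v _ => by simp
    have hDc : ∀ v, ∃ z : ℤ, (D : ℚ) * c v = z := by
      intro v
      refine ⟨(∏ w ∈ Finset.univ.erase v, ((c w).den : ℤ)) * (c v).num, ?_⟩
      simp only [D]
      rw [← Finset.prod_erase_mul _ _ (Finset.mem_univ v)]
      push_cast
      rw [mul_assoc, Rat.den_mul_eq_num]
    choose z hz using hDc
    have hzL : ∀ M, (D : ℚ) * L (fun v => (N M v : ℚ)) = ((∑ v : G, N M v * z v : ℤ) : ℚ) := by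
      intro M
      rw [hL, Finset.mul_sum]
      push_cast
      refine Finset.sum_congr rfl fun v _ => ?_
      rw [← hz]; ring
    have hlim : Tendsto (fun M => ((∑ v : G, N M v * z v : ℤ) : ℂ)) l (𝓝 0) := by
      have h1 : ∀ M, ((∑ v : G, N M v * z v : ℤ) : ℂ) = ∑ v : G,
          (D : ℂ) * c v * ((N M v : ℂ) - eval (fun i => ((v : σ → ℕ) i : ℂ)) (Φ M)) := by
        intro M
        simp only [mul_sub, Finset.sum_sub_distrib]
        have h2 : ∑ v : G, (D : ℂ) * c v * eval (fun i => ((v : σ → ℕ) i : ℂ)) (Φ M) = 0 := by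
          rw [← mul_zero (D : ℂ), ← hkill M, Finset.mul_sum]
          exact Finset.sum_congr rfl fun v _ => by ring
        rw [h2, sub_zero]
        push_cast
        refine Finset.sum_congr rfl fun v _ => ?_
        have h3 : (D : ℂ) * c v = z v := by exact_mod_cast congrArg (fun q : ℚ => (q : ℂ)) (hz v)
        rw [h3, mul_comm]
      simp_rw [h1]
      rw [show (0 : ℂ) = ∑ v : G, (D : ℂ) * c v * 0 by simp]
      exact tendsto_finsetSum _ fun v _ => (h v v.2).const_mul _
    have hlt := (hlim.norm).eventually (gt_mem_nhds (by simp : ‖(0 : ℂ)‖ < 1))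
    filter_upwards [hlt] with M hM
    have h0 : (∑ v : G, N M v * z v : ℤ) = 0 := by
      rw [Complex.norm_intCast] at hM
      rw [← Int.abs_lt_one_iff]
      exact_mod_cast hM
    have h1 := hzL M
    rw [h0, Int.cast_zero] at h1
    exact (mul_eq_zero.mp h1).resolve_left (by exact_mod_cast hD)
  rw [← eventually_all] at key
  filter_upwards [key] with M hM
  have h0 : E.mkQ (fun v : G => (N M v : ℚ)) = 0 := b.ext_elem fun j => by
    simpa using hM j
  rw [Submodule.mkQ_apply, Submodule.Quotient.mk_eq_zero] at h0
  obtain ⟨H, hH, hev⟩ := h0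
  refine ⟨H, (mem_restrictTotalDegree _ _ _).mp hH, fun v hv => ?_⟩
  simpa [ev] using congrFun hev ⟨v, hv⟩

section Branches

open Polynomial Filter Topology

variable {σ : Type*}

/-- Substitution of `p + τ ε` for the variables, as a polynomial in `ε` over the polynomials
in `τ`. -/
noncomputable def shiftHom (p : σ → ℚ) : MvPolynomial σ ℚ →+* (MvPolynomial σ ℂ)[X] :=
  MvPolynomial.eval₂Hom (algebraMap ℚ _)
    fun i => C (MvPolynomial.C (p i : ℂ)) + C (MvPolynomial.X i) * X

/-- Evaluation of a polynomial in `ε` over the polynomials in `τ`. -/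
noncomputable def evalAt (τ : σ → ℕ) (ε : ℂ) : (MvPolynomial σ ℂ)[X] →+* ℂ :=
  eval₂RingHom (MvPolynomial.eval fun i => (τ i : ℂ)) ε

theorem evalAt_comp_shiftHom (p : σ → ℚ) (τ : σ → ℕ) (M : ℕ) :
    (evalAt τ (M : ℂ)⁻¹).comp (shiftHom p) =
      (algebraMap ℚ ℂ).comp (MvPolynomial.eval fun i => p i + τ i / M) := by
  refine MvPolynomial.ringHom_ext' (Subsingleton.elim _ _) fun i => ?_
  simp [evalAt, shiftHom, div_eq_mul_inv]

theorem constantCoeff_comp_shiftHom (p : σ → ℚ) :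
    (constantCoeff (R := MvPolynomial σ ℂ)).comp (shiftHom p) =
      (MvPolynomial.C.comp (algebraMap ℚ ℂ)).comp (MvPolynomial.eval p) := by
  refine MvPolynomial.ringHom_ext' (Subsingleton.elim _ _) fun i => ?_
  simp [shiftHom]

theorem tendsto_evalAt (τ : σ → ℕ) (Q : (MvPolynomial σ ℂ)[X]) :
    Tendsto (fun M : ℕ => evalAt τ (M : ℂ)⁻¹ Q) atTop (𝓝 (evalAt τ 0 Q)) := by
  have h : ∀ ε, evalAt τ ε Q = (Q.map (MvPolynomial.eval fun i => (τ i : ℂ))).eval ε := fun ε => by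
    rw [evalAt, coe_eval₂RingHom, eval₂_eq_eval_map]
  simp only [h]
  exact ((Polynomial.continuous _).tendsto 0).comp tendsto_inv_atTop_nhds_zero_nat

/-- Approximate roots near `p`: for a simple root `r` of `f(p, ·)` and every `k` there is a
polynomial branch through `r` on which `f` vanishes to order `k + 1`. -/
theorem exists_branch (f : (MvPolynomial σ ℚ)[X]) (p : σ → ℚ)
    (hsep : (f.map (MvPolynomial.eval p)).Separable) (r : ℂ)
    (hr : aeval r (f.map (MvPolynomial.eval p)) = 0) (k : ℕ) :
    ∃ Y Q Q' : (MvPolynomial σ ℂ)[X], Y = C (MvPolynomial.C r) + X * Q ∧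
      (f.map (shiftHom p)).eval Y = X ^ (k + 1) * Q' := by
  have hmem : ∀ q : (MvPolynomial σ ℂ)[X], q ∈ Ideal.span {(X : (MvPolynomial σ ℂ)[X])} ↔
      constantCoeff q = 0 := fun q => by
    rw [Ideal.mem_span_singleton, X_dvd_iff, constantCoeff_apply]
  have hev : ∀ g : (MvPolynomial σ ℚ)[X],
      constantCoeff ((g.map (shiftHom p)).eval (C (MvPolynomial.C r))) =
        MvPolynomial.C (aeval r (g.map (MvPolynomial.eval p))) := by
    intro g
    rw [← Polynomial.eval_map_apply, Polynomial.map_map, constantCoeff_comp_shiftHom,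
      ← Polynomial.map_map, ← Polynomial.map_map, aeval_def, eval₂_eq_eval_map]
    simp only [constantCoeff_apply, coeff_C_zero]
    rw [Polynomial.eval_map_apply]
  obtain ⟨Y, hY, hQ'⟩ := exists_sub_mem_eval_mem_pow (Ideal.span {X}) (f.map (shiftHom p))
    (C (MvPolynomial.C r))
    (C (MvPolynomial.C (aeval r (f.map (MvPolynomial.eval p)).derivative)⁻¹)) (by
      rw [hmem, hev, hr, map_zero]) (by
      have h0 := hsep.aeval_derivative_ne_zero hr
      rw [derivative_map] at h0
      simp only [derivative_map]
      rw [hmem, map_sub, map_mul, hev, constantCoeff_apply, coeff_C_zero,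
        ← map_mul, inv_mul_cancel₀ h0]
      simp) k
  rw [Ideal.mem_span_singleton] at hY
  rw [Ideal.span_singleton_pow, Ideal.mem_span_singleton] at hQ'
  obtain ⟨Q, hQ⟩ := hY
  obtain ⟨Q', hQ'⟩ := hQ'
  exact ⟨Y, Q, Q', by rw [← hQ]; ring, hQ'⟩

/-- Actual roots of `f(p + τ / M, ·)` close to prescribed branches. -/
theorem exists_tendsto_root (f : (MvPolynomial σ ℚ)[X]) (hf : f.Monic) (hn : 1 ≤ f.natDegree)
    (p : σ → ℚ) (d : ℕ) (Y Q' : (MvPolynomial σ ℂ)[X])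
    (hQ' : (f.map (shiftHom p)).eval Y = X ^ (d * f.natDegree + 1) * Q') (τ : σ → ℕ) :
    ∃ ρ : ℕ → ℂ,
      (∀ M : ℕ, (((f.map (MvPolynomial.eval fun i => p i + τ i / M)).map
        (algebraMap ℚ ℂ)).IsRoot (ρ M))) ∧
      Tendsto (fun M : ℕ => (M : ℂ) ^ d * (ρ M - evalAt τ (M : ℂ)⁻¹ Y)) atTop (𝓝 0) := by
  let F : ℕ → ℂ[X] := fun M =>
    (f.map (MvPolynomial.eval fun i => p i + τ i / M)).map (algebraMap ℚ ℂ)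
  have hF : ∀ M, (F M).Monic := fun M => (hf.map _).map _
  have hdeg : ∀ M, (F M).natDegree = f.natDegree := fun M => by
    rw [(hf.map _).natDegree_map, hf.natDegree_map]
  have hev : ∀ M : ℕ, (F M).eval (evalAt τ (M : ℂ)⁻¹ Y) =
      ((M : ℂ)⁻¹) ^ (d * f.natDegree + 1) * evalAt τ (M : ℂ)⁻¹ Q' := by
    intro M
    have h1 : evalAt τ (M : ℂ)⁻¹ X = (M : ℂ)⁻¹ := by simp [evalAt]
    have h2 := congrArg (evalAt τ (M : ℂ)⁻¹) hQ'
    rw [← Polynomial.eval_map_apply, Polynomial.map_map, evalAt_comp_shiftHom,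
      ← Polynomial.map_map, map_mul, map_pow, h1] at h2
    exact h2
  choose ρ hρ hle using fun M : ℕ => exists_isRoot_norm_sub_pow_le (hF M)
    (by rw [hdeg]; exact hn) (evalAt τ (M : ℂ)⁻¹ Y)
  refine ⟨ρ, hρ, ?_⟩
  have hpow : Tendsto (fun M : ℕ =>
      ‖(M : ℂ) ^ d * (ρ M - evalAt τ (M : ℂ)⁻¹ Y)‖ ^ f.natDegree) atTop (𝓝 0) := by
    have hb : Tendsto (fun M : ℕ => ‖(M : ℂ)⁻¹ * evalAt τ (M : ℂ)⁻¹ Q'‖) atTop (𝓝 0) := by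
      have := ((tendsto_inv_atTop_nhds_zero_nat (𝕜 := ℂ)).mul (tendsto_evalAt τ Q')).norm
      simpa using this
    refine squeeze_zero' (Eventually.of_forall fun M => by positivity) ?_ hb
    filter_upwards [eventually_gt_atTop 0] with M hM
    have hM' : (M : ℂ) ≠ 0 := by exact_mod_cast hM.ne'
    have h3 := hle M
    rw [hdeg, hev] at h3
    calc _ = ‖(M : ℂ) ^ (d * f.natDegree)‖ * ‖evalAt τ (M : ℂ)⁻¹ Y - ρ M‖ ^ f.natDegree := by
            rw [norm_mul, mul_pow, norm_sub_rev, pow_mul, norm_pow _ f.natDegree]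
      _ ≤ ‖(M : ℂ) ^ (d * f.natDegree)‖ *
            ‖((M : ℂ)⁻¹) ^ (d * f.natDegree + 1) * evalAt τ (M : ℂ)⁻¹ Q'‖ := by gcongr
      _ = _ := by
            rw [← norm_mul]
            congr 1
            generalize evalAt τ (M : ℂ)⁻¹ Q' = E
            rw [inv_pow]
            field_simp
            ring
  have hroot := hpow.rpow_const (p := (f.natDegree : ℝ)⁻¹) (Or.inr (by positivity))
  rw [Real.zero_rpow (by positivity)] at hroot
  rw [tendsto_zero_iff_norm_tendsto_zero]
  refine hroot.congr fun M => ?_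
  rw [Real.pow_rpow_inv_natCast (norm_nonneg _) (by omega)]

/-- Truncation of a power series in `1 / M` after multiplication by `M ^ d`. -/
theorem tendsto_pow_mul_evalAt_sub (b : (MvPolynomial σ ℂ)[X]) (d : ℕ) (τ : σ → ℕ) :
    Tendsto (fun M : ℕ => (M : ℂ) ^ d * evalAt τ (M : ℂ)⁻¹ b -
      MvPolynomial.eval (fun i => (τ i : ℂ))
        (∑ l ∈ Finset.range (d + 1), MvPolynomial.C ((M : ℂ) ^ (d - l)) * b.coeff l))
      atTop (𝓝 0) := by
  obtain ⟨Q, hQ⟩ : X ^ (d + 1) ∣ b - ∑ l ∈ Finset.range (d + 1), C (b.coeff l) * X ^ l := by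
    rw [X_pow_dvd_iff]
    intro m hm
    simp [finsetSum_coeff, Nat.lt_succ_iff.mp hm]
  have hlim := (tendsto_inv_atTop_nhds_zero_nat (𝕜 := ℂ)).mul (tendsto_evalAt τ Q)
  rw [zero_mul] at hlim
  refine hlim.congr' ?_
  filter_upwards [eventually_gt_atTop 0] with M hM
  have hM' : (M : ℂ) ≠ 0 := by exact_mod_cast hM.ne'
  have h1 : evalAt τ (M : ℂ)⁻¹ X = (M : ℂ)⁻¹ := by simp [evalAt]
  have h2 : ∀ a, evalAt τ (M : ℂ)⁻¹ (C a) = MvPolynomial.eval (fun i => (τ i : ℂ)) a := by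
    simp [evalAt]
  rw [sub_eq_iff_eq_add] at hQ
  rw [congrArg (evalAt τ (M : ℂ)⁻¹) hQ]
  simp only [map_add, map_mul, map_pow, h1, h2, map_sum, mul_add, Finset.mul_sum,
    MvPolynomial.eval_C]
  have h3 : ∑ l ∈ Finset.range (d + 1), (M : ℂ) ^ d *
        (MvPolynomial.eval (fun i => (τ i : ℂ)) (b.coeff l) * (M : ℂ)⁻¹ ^ l) =
      ∑ l ∈ Finset.range (d + 1), (M : ℂ) ^ (d - l) *
        MvPolynomial.eval (fun i => (τ i : ℂ)) (b.coeff l) := by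
    refine Finset.sum_congr rfl fun l hl => ?_
    have hl' : l ≤ d := Nat.lt_succ_iff.mp (Finset.mem_range.mp hl)
    generalize MvPolynomial.eval (fun i => (τ i : ℂ)) (b.coeff l) = E
    conv_lhs => rw [← Nat.sub_add_cancel hl', pow_add, inv_pow]
    field_simp
  rw [h3, add_sub_cancel_right]
  generalize evalAt τ (M : ℂ)⁻¹ Q = E
  rw [inv_pow]
  field_simp
  ring

theorem exists_common_denominator (f : (MvPolynomial σ ℚ)[X]) (p : σ → ℚ) :
    ∃ D : ℕ, 0 < D ∧ ∃ e : ℕ, ∀ (M : ℕ) (τ : σ → ℕ), 0 < M → ∀ i, ∃ z : ℤ,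
      (D * M ^ e : ℚ) * (f.map (MvPolynomial.eval fun i => p i + τ i / M)).coeff i = z := by
  choose D hD e he using fun i => exists_denominator p (f.coeff i)
  refine ⟨∏ i ∈ f.support, D i, Finset.prod_pos fun i _ => hD i, ∑ i ∈ f.support, e i,
    fun M τ hM i => ?_⟩
  rw [coeff_map]
  by_cases hi : i ∈ f.support
  · obtain ⟨z, hz⟩ := he i M τ hM
    refine ⟨(∏ j ∈ f.support.erase i, D j : ℕ) * (M ^ (∑ j ∈ f.support.erase i, e j) : ℕ) * z, ?_⟩
    rw [← Finset.mul_prod_erase _ _ hi, ← Finset.add_sum_erase _ _ hi]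
    push_cast at hz ⊢
    rw [← hz]
    ring
  · exact ⟨0, by simp [notMem_support_iff.mp hi]⟩

/-- The coefficients of monic factors of `f(p + τ / M, ·)`, multiplied by a suitable integer,
are integers that are close to finitely many polynomials in `τ` of bounded degree. -/
theorem exists_coeff_approximation (f : (MvPolynomial σ ℚ)[X]) (hf : f.Monic)
    (hn : 1 ≤ f.natDegree) (p : σ → ℚ) (hsep : (f.map (MvPolynomial.eval p)).Separable) :
    ∃ (κ : Type) (_ : Finite κ) (cpl : κ → κ) (B : ℕ) (s : ℕ → ℕ)
      (Φ : κ → ℕ → ℕ → MvPolynomial σ ℂ), (∀ M, 0 < M → 0 < s M) ∧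
      (∀ k i M, (Φ k i M).totalDegree ≤ B) ∧ ∀ τ : σ → ℕ, ∃ A : κ → ℕ → ℕ → ℂ,
        (∀ k i, Tendsto (fun M => A k i M - MvPolynomial.eval (fun j => (τ j : ℂ)) (Φ k i M))
          atTop (𝓝 0)) ∧
        ∀ᶠ M : ℕ in atTop, ∀ g g' : ℚ[X], g.Monic → g'.Monic →
          g * g' = f.map (MvPolynomial.eval fun i => p i + τ i / M) → ∃ k, ∀ i,
            ((∃ z : ℤ, s M * g.coeff i = z) ∧ ((s M * g.coeff i : ℚ) : ℂ) = A k i M) ∧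
            ((∃ z : ℤ, s M * g'.coeff i = z) ∧
              ((s M * g'.coeff i : ℚ) : ℂ) = A (cpl k) i M) := by
  classical
  obtain ⟨D, hD, e, hDe⟩ := exists_common_denominator f p
  set n := f.natDegree with hn_def
  let J := (f.map (MvPolynomial.eval p)).rootSet ℂ
  have hJcard : Fintype.card J = n := by
    rw [card_rootSet_eq_natDegree hsep (IsAlgClosed.splits _), hf.natDegree_map]
  have hroot : ∀ r : J, aeval (r : ℂ) (f.map (MvPolynomial.eval p)) = 0 := fun r =>
    (mem_rootSet.mp r.2).2
  choose Y Q Q' hY hQ' using fun r : J => exists_branch f p hsep r (hroot r) (e * n * n)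
  let b : Finset J → ℕ → (MvPolynomial σ ℂ)[X] := fun S i => (∏ r ∈ S, (X - C (Y r))).coeff i
  have hb : ∀ S i, n < i → b S i = 0 := by
    intro S i hi
    refine coeff_eq_zero_of_natDegree_lt (lt_of_le_of_lt ?_ hi)
    rw [natDegree_prod_of_monic _ _ fun r _ => monic_X_sub_C _]
    simp only [natDegree_X_sub_C, Finset.sum_const, smul_eq_mul, mul_one]
    rw [← hJcard]
    exact Finset.card_le_univ S
  let B : ℕ := Finset.univ.sup fun S => (Finset.range (n + 1)).sup fun i =>
    (Finset.range (e * n + 1)).sup fun l => ((b S i).coeff l).totalDegree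
  have hB : ∀ S i l, l < e * n + 1 → ((b S i).coeff l).totalDegree ≤ B := by
    intro S i l hl
    rcases le_or_gt i n with hi | hi
    · exact (Finset.le_sup (f := fun l => ((b S i).coeff l).totalDegree)
        (Finset.mem_range.mpr hl)).trans ((Finset.le_sup
          (f := fun i => (Finset.range (e * n + 1)).sup fun l => ((b S i).coeff l).totalDegree)
          (Finset.mem_range.mpr (Nat.lt_succ_iff.mpr hi))).trans (Finset.le_sup
          (f := fun S => (Finset.range (n + 1)).sup fun i =>
            (Finset.range (e * n + 1)).sup fun l => ((b S i).coeff l).totalDegree)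
          (Finset.mem_univ S)))
    · simp [hb S i hi]
  refine ⟨Finset J, inferInstance, fun S => Sᶜ, B, fun M => (D * M ^ e) ^ n,
    fun S i M => MvPolynomial.C ((D : ℂ) ^ n) * ∑ l ∈ Finset.range (e * n + 1),
      MvPolynomial.C ((M : ℂ) ^ (e * n - l)) * (b S i).coeff l,
    fun M hM => by positivity, fun S i M => ?_, fun τ => ?_⟩
  · refine (MvPolynomial.totalDegree_mul _ _).trans ?_
    rw [MvPolynomial.totalDegree_C, zero_add]
    refine MvPolynomial.totalDegree_finsetSum_le fun l hl => ?_
    refine (MvPolynomial.totalDegree_mul _ _).trans ?_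
    rw [MvPolynomial.totalDegree_C, zero_add]
    exact hB S i l (Finset.mem_range.mp hl)
  choose ρ hρ hρlim using fun r : J => exists_tendsto_root f hf hn p (e * n) (Y r) (Q' r)
    (hQ' r) τ
  have hy : ∀ r : J, Tendsto (fun M : ℕ => evalAt τ (M : ℂ)⁻¹ (Y r)) atTop (𝓝 (r : ℂ)) := by
    intro r
    have := tendsto_evalAt τ (Y r)
    rwa [show evalAt τ 0 (Y r) = (r : ℂ) by rw [hY]; simp [evalAt]] at this
  have hρr : ∀ r : J, Tendsto (ρ r) atTop (𝓝 (r : ℂ)) := by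
    intro r
    have h0 : Tendsto (fun M => ρ r M - evalAt τ (M : ℂ)⁻¹ (Y r)) atTop (𝓝 0) := by
      refine squeeze_zero_norm' ?_ (tendsto_zero_iff_norm_tendsto_zero.mp (hρlim r))
      filter_upwards [eventually_gt_atTop 0] with M hM
      rw [norm_mul, norm_pow, Complex.norm_natCast]
      exact le_mul_of_one_le_left (norm_nonneg _) (one_le_pow₀ (by exact_mod_cast hM))
    simpa using h0.add (hy r)
  refine ⟨fun S i M => ((D * M ^ e : ℕ) : ℂ) ^ n * (∏ r ∈ S, (X - C (ρ r M))).coeff i,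
    fun S i => ?_, ?_⟩
  · have h1 := tendsto_coeff_prod_X_sub_C atTop (fun M => (M : ℂ) ^ (e * n)) ρ
      (fun r M => evalAt τ (M : ℂ)⁻¹ (Y r)) (fun r => (r : ℂ)) hρr hy hρlim S i
    have h2 := tendsto_pow_mul_evalAt_sub (b S i) (e * n) τ
    have h3 := (h1.add h2).const_mul ((D : ℂ) ^ n)
    rw [add_zero, mul_zero] at h3
    refine h3.congr fun M => ?_
    have h4 : evalAt τ (M : ℂ)⁻¹ (b S i) =
        (∏ r ∈ S, (X - C (evalAt τ (M : ℂ)⁻¹ (Y r)))).coeff i := by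
      rw [← coeff_map, Polynomial.map_prod]
      simp
    rw [← h4, map_mul, MvPolynomial.eval_C]
    push_cast
    rw [mul_pow, ← pow_mul]
    ring
  · have hdist : ∀ᶠ M in atTop, ∀ r r' : J, r ≠ r' → ρ r M ≠ ρ r' M := by
      rw [eventually_all]
      intro r
      rw [eventually_all]
      intro r'
      by_cases h : r = r'
      · exact Eventually.of_forall fun M h' => absurd h h'
      · filter_upwards [((hρr r).sub (hρr r')).eventually_ne
          (sub_ne_zero.mpr fun h' => h (Subtype.ext h'))] with M hM _ using sub_ne_zero.mp hM
    filter_upwards [hdist, eventually_gt_atTop 0] with M hM hM0 g g' hg hg' hgg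
    set F := f.map (MvPolynomial.eval fun i => p i + τ i / M) with hF
    have hFm : F.Monic := hf.map _
    have hFn : F.natDegree = n := hf.natDegree_map _
    have hprod : F.map (algebraMap ℚ ℂ) = ∏ r : J, (X - C (ρ r M)) := by
      refine eq_of_monic_of_dvd_of_natDegree_le (monic_prod_of_monic _ _ fun r _ =>
        monic_X_sub_C _) (hFm.map _) ?_ ?_
      · refine Finset.prod_dvd_of_coprime (fun r _ r' _ hrr => ?_) fun r _ =>
          dvd_iff_isRoot.mpr (hρ r M)
        exact isCoprime_X_sub_C_of_isUnit_sub (sub_ne_zero.mpr (hM r r' hrr)).isUnit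
      · rw [hFm.natDegree_map, hFn, natDegree_prod_of_monic _ _ fun r _ => monic_X_sub_C _]
        simp [hJcard]
    obtain ⟨S, hS, hS'⟩ := exists_finset_eq_prod_X_sub_C (fun r => ρ r M)
      (hg.map (algebraMap ℚ ℂ)) (hg'.map (algebraMap ℚ ℂ))
      (by rw [← Polynomial.map_mul, hgg, hprod])
    have h_int : ∀ h : ℚ[X], h.Monic → h ∣ F → ∀ i,
        ∃ z : ℤ, (((D * M ^ e) ^ n : ℕ) : ℚ) * h.coeff i = z := by
      intro h hh hd i
      obtain ⟨z, hz⟩ := exists_int_pow_mul_coeff_of_dvd hFm hh hd (D * M ^ e : ℕ)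
        (fun i => by exact_mod_cast hDe M τ hM0 i) n hFn.le i
      exact ⟨z, by simpa using hz⟩
    refine ⟨S, fun i => ⟨⟨h_int g hg ⟨g', hgg.symm⟩ i, ?_⟩,
      ⟨h_int g' hg' ⟨g, by rw [← hgg, mul_comm]⟩ i, ?_⟩⟩⟩
    · rw [← hS, coeff_map]
      simp
    · rw [← hS', coeff_map]
      simp
end Branches

section Hilbert

open Polynomial Filter Topology

variable {σ : Type*}

theorem exists_bezout_eq_C {R : Type*} [CommRing R] [IsDomain R] [IsIntegrallyClosed R]
    [CharZero R] {f : R[X]} (hf : f.Monic) (hirr : Irreducible f) :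
    ∃ (d : R) (a b : R[X]), d ≠ 0 ∧ a * f + b * f.derivative = C d := by
  let K := FractionRing R
  have : CharZero K := charZero_of_injective_algebraMap (IsFractionRing.injective R K)
  have hsep : (f.map (algebraMap R K)).Separable :=
    ((hf.irreducible_iff_irreducible_map_fraction_map (K := K)).mp hirr).separable
  obtain ⟨A, B, h⟩ := hsep
  obtain ⟨d, hd, hA⟩ := IsLocalization.integerNormalization_spec (nonZeroDivisors R) A
  obtain ⟨e, he, hB⟩ := IsLocalization.integerNormalization_spec (nonZeroDivisors R) B
  set A' := IsLocalization.integerNormalization (nonZeroDivisors R) A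
  set B' := IsLocalization.integerNormalization (nonZeroDivisors R) B
  refine ⟨d * e, C e * A', C d * B', mul_ne_zero (nonZeroDivisors.ne_zero hd)
    (nonZeroDivisors.ne_zero he), ?_⟩
  apply map_injective (algebraMap R K) (IsFractionRing.injective R K)
  rw [Polynomial.map_add, Polynomial.map_mul, Polynomial.map_mul, Polynomial.map_mul,
    Polynomial.map_mul, hA, hB, map_C, map_C, map_C, ← derivative_map, map_mul, C_mul,
    Algebra.smul_def, Algebra.smul_def]
  simp only [Polynomial.algebraMap_apply]
  linear_combination (C (algebraMap R K d) * C (algebraMap R K e)) * h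

/-- A nonzero polynomial is nonzero at some rational point of a nonempty open set. -/
theorem exists_rat_mem_eval_ne_zero [Fintype σ] {U : Set (σ → ℝ)} (hU : IsOpen U)
    (hne : U.Nonempty) {d : MvPolynomial σ ℚ} (hd : d ≠ 0) :
    ∃ p : σ → ℚ, (fun i => (p i : ℝ)) ∈ U ∧ MvPolynomial.eval p d ≠ 0 := by
  obtain ⟨x, hx⟩ := hne
  obtain ⟨ε, hε, hball⟩ := Metric.isOpen_iff.mp hU x hx
  by_contra! hcon
  refine hd (MvPolynomial.funext_set (fun i => {q : ℚ | |(q : ℝ) - x i| < ε}) (fun i => ?_)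
    fun p hp => ?_)
  · obtain ⟨q₁, h₁, h₁'⟩ := exists_rat_btwn (show x i - ε < x i by linarith)
    obtain ⟨q₂, h₂, h₂'⟩ := exists_rat_btwn (show x i < x i + ε by linarith)
    refine (Set.Ioo_infinite (a := q₁) (b := q₂) (by exact_mod_cast h₁'.trans h₂)).mono
      fun q hq => ?_
    have h3 : (q₁ : ℝ) < q := by exact_mod_cast hq.1
    have h4 : (q : ℝ) < q₂ := by exact_mod_cast hq.2
    rw [Set.mem_ofPred_eq, abs_lt]
    constructor <;> linarith
  · rw [map_zero]
    refine hcon p (hball ?_)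
    rw [Metric.mem_ball, dist_pi_lt_iff hε]
    intro i
    exact hp i (Set.mem_univ i)

theorem exists_rat_mem_forall_separable [Fintype σ] {U : Set (σ → ℝ)} (hU : IsOpen U)
    (hne : U.Nonempty) {ι : Type*} [Fintype ι] (f : ι → (MvPolynomial σ ℚ)[X])
    (hf : ∀ i, (f i).Monic) (hirr : ∀ i, Irreducible (f i)) :
    ∃ p : σ → ℚ, (fun i => (p i : ℝ)) ∈ U ∧ ∀ i, ((f i).map (MvPolynomial.eval p)).Separable := by
  choose d a b hd h using fun i => exists_bezout_eq_C (hf i) (hirr i)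
  obtain ⟨p, hp, hp0⟩ := exists_rat_mem_eval_ne_zero hU hne
    (Finset.prod_ne_zero_iff.mpr fun i (_ : i ∈ Finset.univ) => hd i)
  refine ⟨p, hp, fun i => ?_⟩
  have hi : MvPolynomial.eval p (d i) ≠ 0 := by
    rw [map_prod] at hp0
    exact Finset.prod_ne_zero_iff.mp hp0 i (Finset.mem_univ i)
  have h' := congrArg (Polynomial.map (MvPolynomial.eval p)) (h i)
  rw [Polynomial.map_add, Polynomial.map_mul, Polynomial.map_mul, map_C, ← derivative_map] at h'
  refine ⟨C (MvPolynomial.eval p (d i))⁻¹ * (a i).map (MvPolynomial.eval p),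
    C (MvPolynomial.eval p (d i))⁻¹ * (b i).map (MvPolynomial.eval p), ?_⟩
  rw [mul_assoc, mul_assoc, ← mul_add, h', ← C_mul, inv_mul_cancel₀ hi, C_1]

/-- The affine change of variables `x ↦ p + x / M`. -/
noncomputable def affineEquiv (p : σ → ℚ) (M : ℕ) (hM : 0 < M) :
    MvPolynomial σ ℚ ≃ₐ[ℚ] MvPolynomial σ ℚ :=
  have hM' : (M : ℚ) ≠ 0 := by exact_mod_cast hM.ne'
  AlgEquiv.ofAlgHom
    (MvPolynomial.aeval fun i => MvPolynomial.C (p i) + MvPolynomial.C (M : ℚ)⁻¹ * MvPolynomial.X i)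
    (MvPolynomial.aeval fun i => MvPolynomial.C (M : ℚ) * (MvPolynomial.X i - MvPolynomial.C (p i)))
    (MvPolynomial.algHom_ext fun i => by
      simp only [AlgHom.comp_apply, MvPolynomial.aeval_X, map_mul, map_sub, AlgHom.id_apply,
        MvPolynomial.aeval_C, MvPolynomial.algebraMap_eq]
      rw [add_sub_cancel_left, ← mul_assoc, ← MvPolynomial.C_mul, mul_inv_cancel₀ hM',
        MvPolynomial.C_1, one_mul])
    (MvPolynomial.algHom_ext fun i => by
      simp only [AlgHom.comp_apply, MvPolynomial.aeval_X, map_mul, map_add, AlgHom.id_apply,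
        MvPolynomial.aeval_C, MvPolynomial.algebraMap_eq]
      rw [← mul_assoc, ← MvPolynomial.C_mul, inv_mul_cancel₀ hM',
        MvPolynomial.C_1, one_mul, add_sub_cancel])

theorem eval_affineEquiv (p : σ → ℚ) (M : ℕ) (hM : 0 < M) (v : σ → ℕ) (h : MvPolynomial σ ℚ) :
    MvPolynomial.eval (fun i => (v i : ℚ)) (affineEquiv p M hM h) =
      MvPolynomial.eval (fun i => p i + v i / M) h := by
  change MvPolynomial.eval _ (MvPolynomial.aeval _ h) = _
  rw [MvPolynomial.aeval_def, MvPolynomial.eval₂_eq_eval_map, MvPolynomial.algebraMap_eq]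
  induction h using MvPolynomial.induction_on with
  | C a => simp
  | add f g hf hg => simp only [map_add, hf, hg]
  | mul_X f i hf =>
    rw [map_mul, map_mul, map_mul, map_mul, hf]
    simp [div_eq_inv_mul]

theorem totalDegree_affineEquiv_le (p : σ → ℚ) (M : ℕ) (hM : 0 < M) (h : MvPolynomial σ ℚ) :
    (affineEquiv p M hM h).totalDegree ≤ h.totalDegree := by
  change (MvPolynomial.aeval (R := ℚ) _ h : MvPolynomial σ ℚ).totalDegree ≤ _
  rw [MvPolynomial.aeval_def, MvPolynomial.eval₂_eq]
  refine MvPolynomial.totalDegree_finsetSum_le fun m hm => ?_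
  rw [MvPolynomial.algebraMap_eq]
  refine (MvPolynomial.totalDegree_mul _ _).trans ?_
  rw [MvPolynomial.totalDegree_C, zero_add]
  refine (MvPolynomial.totalDegree_finsetProd _ _).trans
    (le_trans (Finset.sum_le_sum fun i _ => ?_) (MvPolynomial.le_totalDegree hm))
  refine (MvPolynomial.totalDegree_pow _ _).trans (mul_le_of_le_one_right (Nat.zero_le _) ?_)
  refine (MvPolynomial.totalDegree_add _ _).trans (max_le (by simp) ?_)
  refine (MvPolynomial.totalDegree_mul _ _).trans ?_
  simp

/-- If `f(p + v / M, ·)` factors for all `v` in a grid and the coefficients of the factors are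
interpolated by polynomials of small degree, then `f` is not irreducible. -/
theorem not_irreducible_of_interpolants [Fintype σ] {f : (MvPolynomial σ ℚ)[X]}
    (p : σ → ℚ) {M : ℕ} (hM : 0 < M) {B L : ℕ} (hBL : B + B ≤ L)
    (hfL : ∀ i, (f.coeff i).totalDegree ≤ L) {a : ℕ} (ha : 0 < a) (b : σ → ℕ)
    (G : Finset (σ → ℕ)) (hG : ∀ x : σ → ℕ, (∀ i, x i ≤ L) → a • x + b ∈ G) {s : ℚ} (hs : s ≠ 0)
    (g g' : (σ → ℕ) → ℚ[X]) (n : ℕ) (H H' : ℕ → MvPolynomial σ ℚ)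
    (hH : ∀ i ∈ Finset.range (n + 1), (H i).totalDegree ≤ B)
    (hH' : ∀ i ∈ Finset.range (n + 1), (H' i).totalDegree ≤ B)
    (hgH : ∀ v ∈ G, ∀ i ∈ Finset.range (n + 1),
      MvPolynomial.eval (fun j => (v j : ℚ)) (H i) = s * (g v).coeff i)
    (hgH' : ∀ v ∈ G, ∀ i ∈ Finset.range (n + 1),
      MvPolynomial.eval (fun j => (v j : ℚ)) (H' i) = s * (g' v).coeff i)
    (hn : ∀ v ∈ G, (g v).natDegree ≤ n) (hn' : ∀ v ∈ G, (g' v).natDegree ≤ n)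
    (hgg : ∀ v ∈ G, g v * g' v = f.map (MvPolynomial.eval fun i => p i + v i / M))
    (hg : ∀ v ∈ G, 1 ≤ (g v).natDegree) (hg' : ∀ v ∈ G, 1 ≤ (g' v).natDegree) :
    ¬ Irreducible f := by
  classical
  intro hirr
  let P : (ℕ → MvPolynomial σ ℚ) → (MvPolynomial σ ℚ)[X] := fun H =>
    ∑ i ∈ Finset.range (n + 1), C (H i) * X ^ i
  have hP : ∀ H i, (P H).coeff i = if i ∈ Finset.range (n + 1) then H i else 0 := by
    intro H i
    simp [P, finsetSum_coeff]
  have hPdeg : ∀ H : ℕ → MvPolynomial σ ℚ, (∀ i ∈ Finset.range (n + 1), (H i).totalDegree ≤ B) →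
      ∀ i, ((P H).coeff i).totalDegree ≤ B := by
    intro H hH i
    rw [hP]
    split_ifs with hi
    · exact hH i hi
    · simp
  have hPev : ∀ (H : ℕ → MvPolynomial σ ℚ) (g : (σ → ℕ) → ℚ[X]), (∀ v ∈ G,
      ∀ i ∈ Finset.range (n + 1),
        MvPolynomial.eval (fun j => (v j : ℚ)) (H i) = s * (g v).coeff i) →
      (∀ v ∈ G, (g v).natDegree ≤ n) → ∀ v ∈ G,
      (P H).map (MvPolynomial.eval fun j => (v j : ℚ)) = C s * g v := by
    intro H g hgH hn v hv
    ext i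
    rw [coeff_map, hP, coeff_C_mul]
    split_ifs with hi
    · exact hgH v hv i hi
    · rw [coeff_eq_zero_of_natDegree_lt, map_zero, mul_zero]
      have := hn v hv
      simp at hi
      omega
  let e := affineEquiv p M hM
  have key : P H * P H' = C (MvPolynomial.C (s * s)) * f.map (e : MvPolynomial σ ℚ →+* _) := by
    rw [← sub_eq_zero]
    ext1 i
    rw [coeff_zero]
    refine MvPolynomial.eq_zero_of_eval_zero_at_prod_finset _
      (fun j => (Finset.range (L + 1)).image fun t : ℕ => ((a * t + b j : ℕ) : ℚ)) (fun j => ?_)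
      fun x hx => ?_
    · rw [Finset.card_image_of_injective, Finset.card_range, Nat.lt_succ_iff]
      · refine (MvPolynomial.degreeOf_le_totalDegree _ _).trans ?_
        rw [coeff_sub, sub_eq_add_neg]
        refine (MvPolynomial.totalDegree_add _ _).trans (max_le ?_ ?_)
        · rw [coeff_mul]
          refine MvPolynomial.totalDegree_finsetSum_le fun c _ => ?_
          exact (MvPolynomial.totalDegree_mul _ _).trans
            ((add_le_add (hPdeg H hH _) (hPdeg H' hH' _)).trans hBL)
        · rw [MvPolynomial.totalDegree_neg, coeff_C_mul]
          refine (MvPolynomial.totalDegree_mul _ _).trans ?_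
          rw [MvPolynomial.totalDegree_C, zero_add, coeff_map]
          exact (totalDegree_affineEquiv_le p M hM _).trans (hfL i)
      · intro t t' h
        have h' : a * t + b j = a * t' + b j := Nat.cast_injective (R := ℚ) h
        exact Nat.eq_of_mul_eq_mul_left ha (by omega)
    · simp only [Finset.mem_image, Finset.mem_range] at hx
      choose y hy hyx using hx
      have hv : a • y + b ∈ G := hG y fun i => Nat.lt_succ_iff.mp (hy i)
      set v := a • y + b with hv_def
      obtain rfl : (fun j => (v j : ℚ)) = x := by
        ext j
        rw [← hyx j]
        simp [hv_def]
      have h1 : (f.map (e : MvPolynomial σ ℚ →+* _)).map (MvPolynomial.eval fun j => (v j : ℚ)) =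
          f.map (MvPolynomial.eval fun i => p i + v i / M) := by
        rw [Polynomial.map_map]
        congr 1
        exact RingHom.ext fun h => eval_affineEquiv p M hM v h
      rw [← coeff_map, Polynomial.map_sub, Polynomial.map_mul, Polynomial.map_mul, h1,
        hPev H g hgH hn v hv, hPev H' g' hgH' hn' v hv, ← hgg v hv, map_C, MvPolynomial.eval_C,
        C_mul]
      rw [show C s * g v * (C s * g' v) - C s * C s * (g v * g' v) = 0 by ring, coeff_zero]
  have hirr' : Irreducible (f.map (e : MvPolynomial σ ℚ →+* MvPolynomial σ ℚ)) :=
    (MulEquiv.irreducible_iff (Polynomial.mapEquiv e.toRingEquiv)).mpr hirr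
  have hu : IsUnit (C (MvPolynomial.C (s * s)) : (MvPolynomial σ ℚ)[X]) :=
    (((mul_ne_zero hs hs).isUnit.map MvPolynomial.C).map C)
  have hirr'' : Irreducible (P H * P H') := by
    rw [key]
    exact (irreducible_isUnit_mul hu).mpr hirr'
  have hv : a • (0 : σ → ℕ) + b ∈ G := hG 0 fun i => Nat.zero_le _
  have hcon : ∀ (H : ℕ → MvPolynomial σ ℚ) (g : ℚ[X]), 1 ≤ g.natDegree →
      (P H).map (MvPolynomial.eval fun j => ((a • (0 : σ → ℕ) + b) j : ℚ)) = C s * g →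
      ¬ IsUnit (P H) := by
    intro H g hg h hunit
    have h2 := (hunit.map (Polynomial.mapRingHom
      (MvPolynomial.eval fun j => ((a • (0 : σ → ℕ) + b) j : ℚ))))
    rw [coe_mapRingHom, h] at h2
    have h3 := natDegree_eq_zero_of_isUnit h2
    rw [natDegree_C_mul hs] at h3
    omega
  rcases hirr''.isUnit_or_isUnit rfl with h | h
  · exact hcon H _ (hg _ hv) (hPev H g hgH hn _ hv) h
  · exact hcon H' _ (hg' _ hv) (hPev H' g' hgH' hn' _ hv) h

/-- Hilbert irreducibility over `ℚ` with real localization: finitely many monic irreducible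
polynomials stay irreducible under a common rational specialization in a given open set. -/
theorem exists_rat_mem_forall_irreducible [Fintype σ] {U : Set (σ → ℝ)} (hU : IsOpen U)
    (hne : U.Nonempty) {ι : Type*} [Fintype ι] (f : ι → (MvPolynomial σ ℚ)[X])
    (hf : ∀ i, (f i).Monic) (hirr : ∀ i, Irreducible (f i)) :
    ∃ p : σ → ℚ, (fun i => (p i : ℝ)) ∈ U ∧
      ∀ i, Irreducible ((f i).map (MvPolynomial.eval p)) := by
  classical
  by_contra! hcon
  obtain ⟨p, hpU, hsep⟩ := exists_rat_mem_forall_separable hU hne f hf hirr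
  have hdeg : ∀ i, 1 ≤ (f i).natDegree := fun i =>
    (hf i).natDegree_pos_of_not_isUnit (hirr i).not_isUnit
  choose κ hκ cpl B s Φ hs hΦ hA using fun i =>
    exists_coeff_approximation (f i) (hf i) (hdeg i) p (hsep i)
  choose A hAlim hAev using hA
  let l : Ultrafilter ℕ := hyperfilter ℕ
  have hl : (l : Filter ℕ) ≤ atTop := Nat.hyperfilter_le_atTop
  let P : (σ → ℕ) → (Σ i, κ i) → ℕ → Prop := fun τ c M => ∃ g g' : ℚ[X], g.Monic ∧ g'.Monic ∧
    1 ≤ g.natDegree ∧ 1 ≤ g'.natDegree ∧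
    g * g' = (f c.1).map (MvPolynomial.eval fun i => p i + τ i / M) ∧ ∀ j,
      ((∃ z : ℤ, s c.1 M * g.coeff j = z) ∧
        ((s c.1 M * g.coeff j : ℚ) : ℂ) = A c.1 τ c.2 j M) ∧
      ((∃ z : ℤ, s c.1 M * g'.coeff j = z) ∧
        ((s c.1 M * g'.coeff j : ℚ) : ℂ) = A c.1 τ (cpl c.1 c.2) j M)
  have hP : ∀ τ, ∃ c, ∀ᶠ M in (l : Filter ℕ), P τ c M := by
    intro τ
    rw [← Ultrafilter.eventually_exists_iff]
    have hlim : Tendsto (fun M : ℕ => fun i => ((p i + τ i / M : ℚ) : ℝ)) atTop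
        (𝓝 fun i => (p i : ℝ)) := by
      rw [tendsto_pi_nhds]
      intro i
      have := (tendsto_const_div_atTop_nhds_zero_nat (τ i : ℝ)).const_add (p i : ℝ)
      simpa using this
    refine hl ?_
    filter_upwards [hlim.eventually (hU.mem_nhds hpU), eventually_all.mpr fun i => hAev i τ]
      with M hM hM'
    obtain ⟨i, hi⟩ := hcon _ hM
    have hmon := (hf i).map (MvPolynomial.eval fun i => p i + (τ i : ℚ) / M)
    rw [hmon.irreducible_iff_natDegree] at hi
    have h1 : (f i).map (MvPolynomial.eval fun i => p i + (τ i : ℚ) / M) ≠ 1 := by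
      intro h1
      have h2 := congrArg natDegree h1
      rw [(hf i).natDegree_map, natDegree_one] at h2
      have := hdeg i
      omega
    push Not at hi
    obtain ⟨g, g', hg, hg', hgg, hd, hd'⟩ := hi h1
    obtain ⟨k, hk⟩ := hM' i g g' hg hg' hgg
    exact ⟨⟨i, k⟩, g, g', hg, hg', by omega, by omega, hgg, hk⟩
  choose color hcolor using hP
  let L : ℕ := (Finset.univ.sup fun i => B i + B i) +
    Finset.univ.sup fun i => (f i).support.sup fun j => ((f i).coeff j).totalDegree
  obtain ⟨a, ha, b, ⟨i, k⟩, hc⟩ := Combinatorics.exists_mono_homothetic_copy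
    (Fintype.piFinset fun _ : σ => Finset.range (L + 1)) color
  have hBL : B i + B i ≤ L :=
    (Finset.le_sup (f := fun i => B i + B i) (Finset.mem_univ i)).trans (Nat.le_add_right _ _)
  have hfL : ∀ j, ((f i).coeff j).totalDegree ≤ L := by
    intro j
    by_cases hj : j ∈ (f i).support
    · exact ((Finset.le_sup (f := fun j => ((f i).coeff j).totalDegree) hj).trans
        (Finset.le_sup (f := fun i => (f i).support.sup fun j => ((f i).coeff j).totalDegree)
          (Finset.mem_univ i))).trans (Nat.le_add_left _ _)
    · simp [notMem_support_iff.mp hj]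
  let G := (Fintype.piFinset fun _ : σ => Finset.range (L + 1)).image fun x => a • x + b
  have hG : ∀ x : σ → ℕ, (∀ i, x i ≤ L) → a • x + b ∈ G := fun x hx =>
    Finset.mem_image_of_mem _ (by simpa [Nat.lt_succ_iff] using hx)
  have hPG : ∀ v ∈ G, ∀ᶠ M in (l : Filter ℕ), P v ⟨i, k⟩ M := by
    intro v hv
    obtain ⟨x, hx, rfl⟩ := Finset.mem_image.mp hv
    rw [← hc x hx]
    exact hcolor _
  have hex : ∀ v M, ∃ gg : ℚ[X] × ℚ[X], P v ⟨i, k⟩ M → gg.1.Monic ∧ gg.2.Monic ∧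
    1 ≤ gg.1.natDegree ∧ 1 ≤ gg.2.natDegree ∧
    gg.1 * gg.2 = (f i).map (MvPolynomial.eval fun i => p i + v i / M) ∧ ∀ j,
      ((∃ z : ℤ, s i M * gg.1.coeff j = z) ∧
        ((s i M * gg.1.coeff j : ℚ) : ℂ) = A i v k j M) ∧
      ((∃ z : ℤ, s i M * gg.2.coeff j = z) ∧
        ((s i M * gg.2.coeff j : ℚ) : ℂ) = A i v (cpl i k) j M) := by
    intro v M
    by_cases h : P v ⟨i, k⟩ M
    · obtain ⟨g, g', h⟩ := h
      exact ⟨(g, g'), fun _ => h⟩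
    · exact ⟨(0, 0), fun h' => absurd h' h⟩
  choose gg hgg using hex
  have hinterp : ∀ (k' : κ i) (g : (σ → ℕ) → ℕ → ℚ[X]), (∀ v ∈ G, ∀ᶠ M in (l : Filter ℕ), ∀ j,
      (∃ z : ℤ, s i M * (g v M).coeff j = z) ∧
        ((s i M * (g v M).coeff j : ℚ) : ℂ) = A i v k' j M) → ∀ j, ∀ᶠ M in (l : Filter ℕ),
      ∃ H : MvPolynomial σ ℚ, H.totalDegree ≤ B i ∧ ∀ v ∈ G,
        MvPolynomial.eval (fun i => (v i : ℚ)) H = s i M * (g v M).coeff j := by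
    intro k' g hg j
    have hfloor : ∀ v ∈ G, ∀ᶠ M in (l : Filter ℕ),
        ((⌊s i M * (g v M).coeff j⌋ : ℤ) : ℚ) = s i M * (g v M).coeff j := by
      intro v hv
      filter_upwards [hg v hv] with M hM
      obtain ⟨z, hz⟩ := (hM j).1
      rw [hz, Int.floor_intCast]
    have := eventually_exists_interpolant (l : Filter ℕ) G (B i)
      (fun M v => ⌊s i M * (g v M).coeff j⌋) (fun M => Φ i k' j M) (fun M => hΦ i k' j M)
      (fun v hv => by
        refine ((hAlim i v k' j).mono_left hl).congr' ?_
        filter_upwards [hg v hv, hfloor v hv] with M hM hM'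
        rw [← (hM j).2, ← hM', Rat.cast_intCast, Int.floor_intCast])
    filter_upwards [this, (eventually_all_finset G).mpr hfloor] with M ⟨H, hH, hHv⟩ hM
    exact ⟨H, hH, fun v hv => (hHv v hv).trans (hM v hv)⟩
  have h1 := hinterp k (fun v M => (gg v M).1) fun v hv => by
    filter_upwards [hPG v hv] with M hM j using ((hgg v M hM).2.2.2.2.2 j).1
  have h2 := hinterp (cpl i k) (fun v M => (gg v M).2) fun v hv => by
    filter_upwards [hPG v hv] with M hM j using ((hgg v M hM).2.2.2.2.2 j).2
  set n := (f i).natDegree with hn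
  have h3 := (((eventually_all_finset (Finset.range (n + 1))).mpr fun j _ => h1 j).and
    ((eventually_all_finset (Finset.range (n + 1))).mpr fun j _ => h2 j)).and
      (((eventually_all_finset G).mpr hPG).and (hl (eventually_gt_atTop 0)))
  obtain ⟨M, ⟨hH, hH'⟩, hPM, hM0⟩ := h3.exists
  choose! H hHd hHv using hH
  choose! H' hHd' hHv' using hH'
  have hnat : ∀ v ∈ G, (gg v M).1.natDegree + (gg v M).2.natDegree = n := by
    intro v hv
    obtain ⟨hm, hm', -, -, hprod, -⟩ := hgg v M (hPM v hv)
    rw [← hm.natDegree_mul hm', hprod, (hf i).natDegree_map]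
  refine not_irreducible_of_interpolants p hM0 hBL hfL ha b G hG
    (s := s i M) (by exact_mod_cast (hs i M hM0).ne') (fun v => (gg v M).1) (fun v => (gg v M).2)
    n H H' hHd hHd' (fun v hv j hj => hHv j hj v hv) (fun v hv j hj => hHv' j hj v hv)
    (fun v hv => ?_) (fun v hv => ?_) (fun v hv => (hgg v M (hPM v hv)).2.2.2.2.1)
    (fun v hv => (hgg v M (hPM v hv)).2.2.1) (fun v hv => (hgg v M (hPM v hv)).2.2.2.1)
    (hirr i)
  · have := hnat v hv
    omega
  · have := hnat v hv
    omega

end Hilbert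

section Specialization

open Polynomial

theorem exists_rat_mem_forall_irreducible_map_eval {σ : Type*} [Fintype σ] {J : Set ℝ}
    (hJ : IsOpen J) (hne : J.Nonempty) {ι : Type*} [Fintype ι]
    (f : ι → (MvPolynomial σ ℚ)[X][X]) (hf : ∀ i, (f i).Monic) (hirr : ∀ i, Irreducible (f i)) :
    ∃ q : ℚ, (q : ℝ) ∈ J ∧
      ∀ i, Irreducible ((f i).map (evalRingHom (MvPolynomial.C q : MvPolynomial σ ℚ))) := by
  let e := (MvPolynomial.optionEquivLeft ℚ σ).toRingEquiv
  obtain ⟨x, hx⟩ := hne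
  obtain ⟨p, hpJ, hp⟩ := exists_rat_mem_forall_irreducible
    (U := (fun y : Option σ → ℝ => y none) ⁻¹' J) (hJ.preimage (continuous_apply none))
    ⟨fun _ => x, hx⟩
    (fun i => (f i).map (e.symm : (MvPolynomial σ ℚ)[X] →+* MvPolynomial (Option σ) ℚ))
    (fun i => (hf i).map _)
    (fun i => (MulEquiv.irreducible_iff (Polynomial.mapEquiv e.symm)).mpr (hirr i))
  refine ⟨p none, hpJ, fun i => ?_⟩
  refine ((hf i).map _).irreducible_of_irreducible_map
    (MvPolynomial.eval fun j => p (some j)) _ ?_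
  convert hp i using 1
  rw [Polynomial.map_map, Polynomial.map_map]
  congr 1
  have h : ((MvPolynomial.eval fun j => p (some j)).comp
      (evalRingHom (MvPolynomial.C (p none) : MvPolynomial σ ℚ))).comp
        (e : MvPolynomial (Option σ) ℚ →+* (MvPolynomial σ ℚ)[X]) = MvPolynomial.eval p := by
    refine MvPolynomial.ringHom_ext' (Subsingleton.elim _ _) fun j => ?_
    cases j <;> simp [e]
  rw [← h, RingHom.comp_assoc, RingHom.comp_assoc]
  simp

/-- A primitive element that is integral over the base and lies in a prescribed order. -/
theorem exists_mem_isIntegral_natDegree_minpoly_eq {R k E : Type*} [CommRing R] [IsDomain R]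
    [IsIntegrallyClosed R] [Field k] [CharZero k] [Field E] [Algebra R k] [IsFractionRing R k]
    [Algebra k E] [Algebra R E] [IsScalarTower R k E] [FiniteDimensional k E] (S : Subring E)
    (hS : ∀ e : E, ∃ r : R, r ≠ 0 ∧ r • e ∈ S) (hR : ∀ r : R, algebraMap R E r ∈ S) :
    ∃ θ ∈ S, IsIntegral R θ ∧ (minpoly R θ).Monic ∧ Irreducible (minpoly R θ) ∧
      (minpoly R θ).natDegree = Module.finrank k E := by
  obtain ⟨α, hα⟩ := Field.exists_primitive_element k E
  obtain ⟨r, hr, hrS⟩ := hS α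
  obtain ⟨s, hs, h_int⟩ := ((IsFractionRing.isAlgebraic_iff R k E).mpr
    (Algebra.IsAlgebraic.isAlgebraic (r • α))).exists_integral_multiple
  have hmem : s • r • α ∈ S := by
    rw [Algebra.smul_def]
    exact S.mul_mem (hR s) hrS
  refine ⟨s • r • α, hmem, h_int, minpoly.monic h_int, minpoly.irreducible h_int, ?_⟩
  have h1 := minpoly.isIntegrallyClosed_eq_field_fractions k E h_int
  rw [Algebra.algebraMap_self_apply] at h1
  rw [← (minpoly.monic h_int).natDegree_map (algebraMap R k), ← h1,
    ← Field.primitive_element_iff_minpoly_natDegree_eq, eq_top_iff, ← hα,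
    IntermediateField.adjoin_simple_le_iff]
  have h0 : algebraMap R k (s * r) ≠ 0 :=
    (map_ne_zero_iff _ (IsFractionRing.injective R k)).mpr (mul_ne_zero hs hr)
  have h2 : (algebraMap R k (s * r))⁻¹ • s • r • α ∈
      IntermediateField.adjoin k {s • r • α} :=
    IntermediateField.smul_mem _ (IntermediateField.mem_adjoin_simple_self k _)
  rwa [← mul_smul, ← algebraMap_smul k (s * r) α, smul_smul, inv_mul_cancel₀ h0, one_smul,
    algebraMap_smul, mul_smul] at h2

theorem irreducible_of_dvd_comp_of_natDegree_eq {k K : Type*} [Field k] [Field K] [Algebra k K]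
    [FiniteDimensional k K] {P q : K[X]} {f : k[X]} (hP : P ≠ 0) (hf : Irreducible f)
    (hdeg : f.natDegree = P.natDegree * Module.finrank k K)
    (hdvd : P ∣ (f.map (algebraMap k K)).comp q) : Irreducible P := by
  have hd : 0 < Module.finrank k K := Module.finrank_pos
  have hP0 : 0 < P.natDegree := Nat.pos_of_mul_pos_right (hdeg ▸ hf.natDegree_pos)
  obtain ⟨h, hh, hhP⟩ := exists_irreducible_of_natDegree_pos hP0
  have := Fact.mk hh
  have : FiniteDimensional K (AdjoinRoot h) := (AdjoinRoot.powerBasis hh.ne_zero).finite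
  have : FiniteDimensional k (AdjoinRoot h) := FiniteDimensional.trans k K _
  have hroot : aeval (AdjoinRoot.mk h q) f = 0 := by
    have h1 : AdjoinRoot.mk h ((f.map (algebraMap k K)).comp q) = 0 :=
      AdjoinRoot.mk_eq_zero.mpr (hhP.trans hdvd)
    rw [comp, eval₂_map, hom_eval₂] at h1
    rw [aeval_def, ← h1]
    rfl
  have hle : f.natDegree ≤ Module.finrank k (AdjoinRoot h) := by
    refine le_trans (natDegree_le_of_dvd ?_ (minpoly.ne_zero (Algebra.IsIntegral.isIntegral _)))
      (minpoly.natDegree_le (A := k) (AdjoinRoot.mk h q))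
    exact ((minpoly.irreducible (Algebra.IsIntegral.isIntegral _)).associated_of_dvd hf
      (minpoly.dvd k _ hroot)).symm.dvd
  rw [← Module.finrank_mul_finrank k K (AdjoinRoot h), hdeg,
    (AdjoinRoot.powerBasis hh.ne_zero).finrank, AdjoinRoot.powerBasis_dim, mul_comm] at hle
  have hle' : P.natDegree ≤ h.natDegree := Nat.le_of_mul_le_mul_left hle hd
  exact (associated_of_dvd_of_natDegree_le hhP hP hle').irreducible hh

theorem exists_irreducible_dvd_comp (R A k F : Type*) [CommRing R] [IsDomain R]
    [IsIntegrallyClosed R] [CommRing A] [IsDomain A] [IsIntegrallyClosed A] [Algebra R A]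
    [FaithfulSMul R A] [Algebra.IsAlgebraic R A] [Field k] [CharZero k] [Algebra R k]
    [IsFractionRing R k] [Field F] [Algebra A F] [IsFractionRing A F] [Algebra k F]
    [Algebra R F] [IsScalarTower R A F] [IsScalarTower R k F] [FiniteDimensional k F]
    {P : A[X]} (hP : P.Monic) (hirr : Irreducible P) :
    ∃ (q : A[X]) (f : R[X]), f.Monic ∧ Irreducible f ∧
      f.natDegree = P.natDegree * Module.finrank k F ∧
      P ∣ (f.map (algebraMap R A)).comp q := by
  have hirr' := (hP.irreducible_iff_irreducible_map_fraction_map (K := F)).mp hirr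
  have := Fact.mk hirr'
  let φ : A[X] →+* AdjoinRoot (P.map (algebraMap A F)) :=
    (AdjoinRoot.mk _).comp (mapRingHom (algebraMap A F))
  have : FiniteDimensional F (AdjoinRoot (P.map (algebraMap A F))) :=
    (AdjoinRoot.powerBasis hirr'.ne_zero).finite
  have : FiniteDimensional k (AdjoinRoot (P.map (algebraMap A F))) :=
    FiniteDimensional.trans k F _
  have hφ (r : R) : algebraMap R (AdjoinRoot (P.map (algebraMap A F))) r =
      φ (C (algebraMap R A r)) := by
    simp [φ, ← IsScalarTower.algebraMap_apply]
    rfl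
  obtain ⟨_, ⟨q, rfl⟩, h_int, hmonic, hfirr, hdeg⟩ :=
    exists_mem_isIntegral_natDegree_minpoly_eq (R := R) (k := k) φ.range (fun e => by
      obtain ⟨p, rfl⟩ := AdjoinRoot.mk_surjective e
      obtain ⟨b, hb, hbp⟩ := IsLocalization.integerNormalization_spec (nonZeroDivisors A) p
      obtain ⟨r, hr, s, hs⟩ := (Algebra.IsAlgebraic.isAlgebraic (R := R) b).exists_nonzero_dvd hb
      refine ⟨r, hr, C s * IsLocalization.integerNormalization (nonZeroDivisors A) p, ?_⟩
      rw [map_mul, Algebra.smul_def, hφ, hs, mul_comm b, map_mul, map_mul, mul_assoc]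
      congr 1
      change AdjoinRoot.mk _ (Polynomial.map _ _) = AdjoinRoot.mk _ _ * AdjoinRoot.mk _ p
      rw [hbp, ← map_mul, Algebra.smul_def, IsScalarTower.algebraMap_apply A F F[X]]
      simp)
      (fun r => ⟨_, (hφ r).symm⟩)
  refine ⟨q, minpoly R (φ q), hmonic, hfirr, ?_, ?_⟩
  · rw [hdeg, ← Module.finrank_mul_finrank k F, (AdjoinRoot.powerBasis hirr'.ne_zero).finrank,
      AdjoinRoot.powerBasis_dim, hP.natDegree_map, mul_comm]
  · rw [← map_dvd_map _ (IsFractionRing.injective A F) hP]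
    rw [← AdjoinRoot.mk_eq_zero]
    change φ _ = 0
    rw [comp, eval₂_map, hom_eval₂, ← minpoly.aeval R (φ q), aeval_def]
    congr 1
    ext r
    exact (hφ r).symm

attribute [local instance] Polynomial.algebra FractionRing.liftAlgebra in
theorem exists_rat_mem_forall_irreducible_map_evalRingHom_of_finite {σ K : Type*} [Fintype σ]
    [Field K] [CharZero K] [Algebra (MvPolynomial σ ℚ) K] [FaithfulSMul (MvPolynomial σ ℚ) K]
    [FiniteDimensional (FractionRing (MvPolynomial σ ℚ)) K]
    {J : Set ℝ} (hJ : IsOpen J) (hne : J.Nonempty) {ι : Type*} [Fintype ι]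
    (P : ι → K[X][X]) (hP : ∀ i, (P i).Monic) (hirr : ∀ i, Irreducible (P i)) :
    ∃ q : ℚ, (q : ℝ) ∈ J ∧ ∀ i, Irreducible ((P i).map (evalRingHom (q : K))) := by
  have : Algebra.IsAlgebraic (MvPolynomial σ ℚ) K :=
    (IsFractionRing.comap_isAlgebraic_iff (K := FractionRing (MvPolynomial σ ℚ))).mpr inferInstance
  have hrank : Module.rank (FractionRing (MvPolynomial σ ℚ)[X]) (FractionRing K[X]) =
      Module.rank (FractionRing (MvPolynomial σ ℚ)) K := by
    rw [Algebra.IsAlgebraic.rank_fractionRing_polynomial,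
      Algebra.IsAlgebraic.rank_of_isFractionRing (MvPolynomial σ ℚ)
        (FractionRing (MvPolynomial σ ℚ)) K K]
  have hfin : FiniteDimensional (FractionRing (MvPolynomial σ ℚ)[X]) (FractionRing K[X]) := by
    rw [FiniteDimensional, ← Module.rank_lt_aleph0_iff, hrank]
    exact Module.rank_lt_aleph0 _ _
  have hfinrank := congrArg Cardinal.toNat hrank
  change Module.finrank _ _ = Module.finrank _ _ at hfinrank
  choose q f hf hfirr hdeg hdvd using fun i => exists_irreducible_dvd_comp
    (MvPolynomial σ ℚ)[X] K[X] (FractionRing (MvPolynomial σ ℚ)[X]) (FractionRing K[X])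
    (hP i) (hirr i)
  obtain ⟨c, hcJ, hc⟩ := exists_rat_mem_forall_irreducible_map_eval hJ hne f hf hfirr
  refine ⟨c, hcJ, fun i => ?_⟩
  have h1 := (((hf i).map _).irreducible_iff_irreducible_map_fraction_map
    (K := FractionRing (MvPolynomial σ ℚ))).mp (hc i)
  refine irreducible_of_dvd_comp_of_natDegree_eq (q := (q i).map (evalRingHom (c : K)))
    ((hP i).map _).ne_zero h1 ?_ ?_
  · rw [((hf i).map _).natDegree_map, (hf i).natDegree_map, (hP i).natDegree_map, hdeg, hfinrank]
  · convert Polynomial.map_dvd (evalRingHom (c : K)) (hdvd i) using 1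
    rw [Polynomial.map_comp, Polynomial.map_map, Polynomial.map_map, Polynomial.map_map]
    congr 2
    ext
    · simp
    · simp [← IsScalarTower.algebraMap_apply]
    · have h2 : algebraMap (MvPolynomial σ ℚ) K (MvPolynomial.C c) = c :=
        eq_ratCast ((algebraMap (MvPolynomial σ ℚ) K).comp MvPolynomial.C) c
      simp [← IsScalarTower.algebraMap_apply, h2]

theorem exists_rat_mem_forall_irreducible_map_evalRingHom {K : Type*} [Field K] [CharZero K]
    {s : Set K} (hs : s.Finite) (hclo : Subfield.closure s = ⊤)
    {J : Set ℝ} (hJ : IsOpen J) (hne : J.Nonempty) {ι : Type*} [Fintype ι]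
    (P : ι → K[X][X]) (hP : ∀ i, (P i).Monic) (hirr : ∀ i, Irreducible (P i)) :
    ∃ q : ℚ, (q : ℝ) ∈ J ∧ ∀ i, Irreducible ((P i).map (evalRingHom (q : K))) := by
  have halg : Algebra.IsAlgebraic (Algebra.adjoin ℚ s) K := by
    refine ⟨fun x => ?_⟩
    have hx : x ∈ Subfield.closure s := hclo ▸ Subfield.mem_top x
    induction hx using Subfield.closure_induction with
    | mem x hx => exact isAlgebraic_algebraMap (⟨x, Algebra.subset_adjoin hx⟩ :
        Algebra.adjoin ℚ s)
    | one => exact isAlgebraic_one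
    | add x y _ _ hx hy => exact hx.add hy
    | neg x _ hx => exact hx.neg
    | inv x _ hx => exact hx.inv
    | mul x y _ _ hx hy => exact hx.mul hy
  obtain ⟨t, hts, ht⟩ := exists_isTranscendenceBasis_subset (R := ℚ) s
  have : Fintype t := (hs.subset hts).fintype
  let := (MvPolynomial.aeval (R := ℚ) ((↑) : t → K) : MvPolynomial t ℚ →+* K).toAlgebra
  have : FaithfulSMul (MvPolynomial t ℚ) K :=
    (faithfulSMul_iff_algebraMap_injective _ _).mpr ht.1
  have : Algebra.IsAlgebraic (MvPolynomial t ℚ) K :=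
    (Algebra.isAlgebraic_ringHom_iff_of_comp_eq ht.1.aevalEquiv (RingEquiv.refl K)
      (by ext <;> rfl)).mp ht.isAlgebraic
  let := FractionRing.liftAlgebra (MvPolynomial t ℚ) K
  have : IsScalarTower (MvPolynomial t ℚ) (FractionRing (MvPolynomial t ℚ)) K :=
    FractionRing.isScalarTower_liftAlgebra _ _
  have : FiniteDimensional (FractionRing (MvPolynomial t ℚ)) K := by
    have := hs.to_subtype
    have h_int (x : K) : IsIntegral (FractionRing (MvPolynomial t ℚ)) x :=
      (IsFractionRing.isAlgebraic_iff (MvPolynomial t ℚ) (FractionRing (MvPolynomial t ℚ)) K).mp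
        (Algebra.IsAlgebraic.isAlgebraic x) |>.isIntegral
    have h1 := IntermediateField.finiteDimensional_adjoin
      (K := FractionRing (MvPolynomial t ℚ)) (S := s) fun x _ => h_int x
    have h2 : IntermediateField.adjoin (FractionRing (MvPolynomial t ℚ)) s = ⊤ := by
      rw [eq_top_iff]
      intro x _
      have hx : x ∈ Subfield.closure s := hclo ▸ Subfield.mem_top x
      exact (Subfield.closure_le (t := (IntermediateField.adjoin
        (FractionRing (MvPolynomial t ℚ)) s).toSubfield)).mpr
          (IntermediateField.subset_adjoin _ s) hx
    rw [h2] at h1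
    exact Module.Finite.equiv IntermediateField.topEquiv.toLinearEquiv
  exact exists_rat_mem_forall_irreducible_map_evalRingHom_of_finite (σ := t) hJ hne P hP hirr

theorem exists_ringHom_comp_algebraMap_eq {R A K Ω : Type*} [CommRing R] [CommRing A]
    [Algebra R A] [Algebra.IsIntegral R A] [FaithfulSMul R A] [Field K] [Field Ω] [Algebra K Ω]
    [IsAlgClosed Ω] {e : R →+* K} (he : Function.Surjective e) :
    ∃ ψ : A →+* Ω, ψ.comp (algebraMap R A) = (algebraMap K Ω).comp e := by
  have hmax : (RingHom.ker e).IsMaximal := RingHom.ker_isMaximal_of_surjective e he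
  obtain ⟨M, hM, hcomap⟩ := Ideal.exists_ideal_over_maximal_of_isIntegral (S := A)
    (RingHom.ker e) (by
      rw [(RingHom.injective_iff_ker_eq_bot _).mp (FaithfulSMul.algebraMap_injective R A)]
      exact bot_le)
  have : M.LiesOver (RingHom.ker e) := ⟨hcomap.symm⟩
  let := Ideal.Quotient.field (RingHom.ker e)
  let := Ideal.Quotient.field M
  let := ((algebraMap K Ω).comp e.kerLift).toAlgebra
  have : Algebra.IsIntegral (R ⧸ RingHom.ker e) (A ⧸ M) := inferInstance
  let φ : A ⧸ M →ₐ[R ⧸ RingHom.ker e] Ω := IsAlgClosed.lift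
  refine ⟨(φ : A ⧸ M →+* Ω).comp (Ideal.Quotient.mk M), ?_⟩
  ext r
  exact φ.commutes (Ideal.Quotient.mk _ r)

theorem exists_smul_mem_adjoin {R k E : Type*} [CommRing R] [IsDomain R] [Field k] [Field E]
    [Algebra R k] [IsFractionRing R k] [Algebra k E] [Algebra R E] [IsScalarTower R k E]
    {s : Set E} {x : E} (hx : x ∈ Algebra.adjoin k s) :
    ∃ r : R, r ≠ 0 ∧ r • x ∈ Algebra.adjoin R s := by
  induction hx using Algebra.adjoin_induction with
  | mem x hx => exact ⟨1, one_ne_zero, by simpa using Algebra.subset_adjoin hx⟩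
  | algebraMap z =>
    obtain ⟨a, b, hb, rfl⟩ := IsFractionRing.div_surjective (A := R) z
    refine ⟨b, nonZeroDivisors.ne_zero hb, ?_⟩
    have hb' : algebraMap R k b ≠ 0 := (map_ne_zero_iff _ (IsFractionRing.injective R k)).mpr
      (nonZeroDivisors.ne_zero hb)
    rw [Algebra.smul_def, IsScalarTower.algebraMap_apply R k E, ← map_mul,
      mul_div_cancel₀ _ hb', ← IsScalarTower.algebraMap_apply]
    exact Subalgebra.algebraMap_mem _ _
  | add x y _ _ hx hy =>
    obtain ⟨r, hr, hrx⟩ := hx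
    obtain ⟨t, ht, hty⟩ := hy
    refine ⟨r * t, mul_ne_zero hr ht, ?_⟩
    rw [smul_add, mul_comm, mul_smul, mul_comm, mul_smul]
    exact add_mem (Subalgebra.smul_mem _ hrx t) (Subalgebra.smul_mem _ hty r)
  | mul x y _ _ hx hy =>
    obtain ⟨r, hr, hrx⟩ := hx
    obtain ⟨t, ht, hty⟩ := hy
    refine ⟨r * t, mul_ne_zero hr ht, ?_⟩
    rw [← smul_mul_smul_comm]
    exact mul_mem hrx hty

theorem exists_rat_irreducible_and_finrank_splittingField_dvd {K F : Type*} [Field K]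
    [CharZero K] {s : Set K} (hs : s.Finite) (hclo : Subfield.closure s = ⊤) [Field F]
    [Algebra K[X] F] [IsFractionRing K[X] F] {J : Set ℝ} (hJ : IsOpen J) (hne : J.Nonempty)
    {P : K[X][X]} (hP : P.Monic) (hirr : Irreducible P) :
    ∃ q : ℚ, (q : ℝ) ∈ J ∧ Irreducible (P.map (evalRingHom (q : K))) ∧
      Module.finrank F (P.map (algebraMap K[X] F)).SplittingField ∣
        Module.finrank K (P.map (evalRingHom (q : K))).SplittingField := by
  have : CharZero F := charZero_of_injective_algebraMap (IsFractionRing.injective K[X] F)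
  set L := (P.map (algebraMap K[X] F)).SplittingField with hL
  set T : Set L := (P.map (algebraMap K[X] F)).rootSet L with hT
  have hroot (x : L) (hx : x ∈ T) : aeval x P = 0 := by
    rw [mem_rootSet, aeval_map_algebraMap] at hx
    exact hx.2
  obtain ⟨θ, hθT, h_int, hmonic, hθirr, hdeg⟩ := exists_mem_isIntegral_natDegree_minpoly_eq
    (R := K[X]) (k := F) (E := L) (Algebra.adjoin K[X] T).toSubring
    (fun x => exists_smul_mem_adjoin (k := F) (by
      rw [hT, IsSplittingField.adjoin_rootSet]
      exact Algebra.mem_top))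
    (fun r => Subalgebra.algebraMap_mem _ r)
  obtain ⟨q, hqJ, hq⟩ := exists_rat_mem_forall_irreducible_map_evalRingHom hs hclo hJ hne
    ![P, minpoly K[X] θ] (by simp [Fin.forall_fin_two, hP, hmonic])
    (by simp [Fin.forall_fin_two, hirr, hθirr])
  obtain ⟨hq0, hq1⟩ : Irreducible (P.map (evalRingHom (q : K))) ∧
      Irreducible ((minpoly K[X] θ).map (evalRingHom (q : K))) := Fin.forall_fin_two.mp hq
  refine ⟨q, hqJ, hq0, ?_⟩
  have : Algebra.IsIntegral K[X] (Algebra.adjoin K[X] T) :=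
    Algebra.IsIntegral.adjoin fun x hx => ⟨P, hP, hroot x hx⟩
  have : FaithfulSMul K[X] (Algebra.adjoin K[X] T) := by
    rw [faithfulSMul_iff_algebraMap_injective]
    refine Function.Injective.of_comp (f := algebraMap (Algebra.adjoin K[X] T) L) ?_
    rw [← RingHom.coe_comp, ← IsScalarTower.algebraMap_eq, IsScalarTower.algebraMap_eq K[X] F L]
    exact (algebraMap F L).injective.comp (IsFractionRing.injective K[X] F)
  obtain ⟨ψ, hψ⟩ := exists_ringHom_comp_algebraMap_eq (A := Algebra.adjoin K[X] T)
    (Ω := AlgebraicClosure K) (e := evalRingHom (q : K)) (fun a => ⟨C a, by simp⟩)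
  have haeval (f : K[X][X]) (x : Algebra.adjoin K[X] T) :
      aeval (ψ x) (f.map (evalRingHom (q : K))) = ψ (aeval x f) := by
    rw [aeval_def, aeval_def, hom_eval₂, eval₂_map, hψ]
  have hψθ : ψ ⟨θ, hθT⟩ ∈ IntermediateField.adjoin K
      ((P.map (evalRingHom (q : K))).rootSet (AlgebraicClosure K)) := by
    have key (x : L) (hx : x ∈ Algebra.adjoin K[X] T) : ψ ⟨x, hx⟩ ∈ IntermediateField.adjoin K
        ((P.map (evalRingHom (q : K))).rootSet (AlgebraicClosure K)) := by
      induction hx using Algebra.adjoin_induction with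
      | mem x hx =>
        refine IntermediateField.subset_adjoin _ _ ((mem_rootSet_of_ne
          (hP.map _).ne_zero).mpr ?_)
        rw [haeval, ← map_zero ψ]
        congr 1
        exact Subtype.ext (by
          rw [← Subalgebra.coe_val, ← aeval_algHom_apply, Subalgebra.coe_val, hroot x hx]
          rfl)
      | algebraMap r =>
        have h1 := RingHom.congr_fun hψ r
        exact Set.mem_of_eq_of_mem h1 (IntermediateField.algebraMap_mem _ _)
      | add x y hx hy h1 h2 =>
        exact Set.mem_of_eq_of_mem (map_add ψ ⟨x, hx⟩ ⟨y, hy⟩) (add_mem h1 h2)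
      | mul x y hx hy h1 h2 =>
        exact Set.mem_of_eq_of_mem (map_mul ψ ⟨x, hx⟩ ⟨y, hy⟩) (mul_mem h1 h2)
    exact key θ hθT
  have hsplit := IntermediateField.adjoin_rootSet_isSplittingField (L := AlgebraicClosure K)
    (p := P.map (evalRingHom (q : K))) (IsAlgClosed.splits _)
  have hmin := minpoly.eq_of_irreducible_of_monic (x := ψ ⟨θ, hθT⟩) hq1 (by
    rw [haeval, ← map_zero ψ]
    congr 1
    exact Subtype.ext (by
      rw [← Subalgebra.coe_val, ← aeval_algHom_apply, Subalgebra.coe_val, minpoly.aeval]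
      rfl)) (hmonic.map _)
  rw [← hdeg, ← hmonic.natDegree_map (evalRingHom (q : K)),
    ← (IsSplittingField.algEquiv _ (P.map (evalRingHom (q : K)))
      (h := hsplit)).toLinearEquiv.finrank_eq, hmin,
    ← IntermediateField.adjoin.finrank (Algebra.IsIntegral.isIntegral _)]
  exact IntermediateField.finrank_dvd_of_le_right
    (IntermediateField.adjoin_simple_le_iff.mpr hψθ)

end Specialization

section QuadraticClosure

open Polynomial

theorem le_Qclo (K : Subfield ℝ) : K ≤ Qclo K :=
  le_sInf fun _ hM => hM.1

theorem Qclo_le {K M : Subfield ℝ} (hK : K ≤ M) (hM : ∀ c ∈ M, 0 ≤ c → √c ∈ M) : Qclo K ≤ M :=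
  sInf_le ⟨hK, hM⟩

theorem sqrt_mem_Qclo {K : Subfield ℝ} {c : ℝ} (hc : c ∈ Qclo K) (h0 : 0 ≤ c) :
    √c ∈ Qclo K :=
  Subfield.mem_sInf.mpr fun _ hM => hM.2 c (Subfield.mem_sInf.mp hc _ hM) h0

theorem mem_Qclo_of_sq_mem {K : Subfield ℝ} {c : ℝ} (hc : c ^ 2 ∈ Qclo K) : c ∈ Qclo K := by
  have h := sqrt_mem_Qclo hc (sq_nonneg c)
  rw [Real.sqrt_sq_eq_abs] at h
  rcases abs_choice c with h' | h' <;> rw [h'] at h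
  · exact h
  · exact neg_mem_iff.mp h

/-- A real root of a quadratic polynomial over the quadratic closure lies in it. -/
theorem mem_Qclo_of_quadratic {K : Subfield ℝ} {p q x : ℝ} (hp : p ∈ Qclo K) (hq : q ∈ Qclo K)
    (h : x ^ 2 = p * x - q) : x ∈ Qclo K := by
  have h2 : (2 : ℝ) ∈ Qclo K := ofNat_mem _ 2
  have h4 : (4 : ℝ) ∈ Qclo K := ofNat_mem _ 4
  have h1 : 2 * x - p ∈ Qclo K := by
    refine mem_Qclo_of_sq_mem ?_
    have : (2 * x - p) ^ 2 = p ^ 2 - 4 * q := by linear_combination 4 * h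
    rw [this]
    exact sub_mem (pow_mem hp 2) (mul_mem h4 hq)
  have : x = (2 * x - p + p) / 2 := by ring
  rw [this]
  exact div_mem (add_mem h1 hp) h2

theorem exists_mem_Qclo_of_fixed {F : Subfield ℝ} {L : Type*} [Field L] [Algebra F L]
    [FiniteDimensional F L] [IsGalois F L] (φ : L →ₐ[F] ℂ) {k : ℕ}
    (hcard : Nat.card Gal(L/F) = 2 ^ k) (j : ℕ) :
    ∀ H : Subgroup Gal(L/F), Nat.card H * 2 ^ j = 2 ^ k →
      (∀ x, (∀ g ∈ H, g x = x) → ∃ r : ℝ, φ x = r) →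
      ∀ x, (∀ g ∈ H, g x = x) → ∃ r ∈ Qclo F, φ x = (r : ℝ) := by
  induction j with
  | zero =>
    intro H hH _ x hx
    rw [pow_zero, mul_one, ← hcard] at hH
    have hmem : x ∈ (⊥ : IntermediateField F L) := (IsGalois.mem_bot_iff_fixed x).mpr fun g =>
      hx g (Subgroup.eq_top_of_card_eq H hH ▸ Subgroup.mem_top g)
    obtain ⟨y, rfl⟩ := IntermediateField.mem_bot.mp hmem
    exact ⟨y, le_Qclo F y.2, φ.commutes y⟩
  | succ j ih =>
    intro H hH hreal x hx
    obtain ⟨n, -, hn⟩ := (Nat.dvd_prime_pow Nat.prime_two).mp (Dvd.intro _ hH)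
    have hdvd : 2 ^ (n + 1) ∣ Nat.card Gal(L/F) := by
      rw [hcard, ← hH, hn, ← pow_add]
      exact pow_dvd_pow _ (by omega)
    obtain ⟨M, hMcard, hHM⟩ := Sylow.exists_subgroup_card_pow_succ hdvd hn
    have hidx : H.relIndex M = 2 := by
      have h1 := Subgroup.relIndex_mul_relIndex ⊥ H M bot_le hHM
      rw [Subgroup.relIndex_bot_left, Subgroup.relIndex_bot_left, hn, hMcard, pow_succ] at h1
      exact Nat.eq_of_mul_eq_mul_left (by positivity) h1
    obtain ⟨a, haM, ha⟩ := Subgroup.relIndex_eq_two_iff.mp hidx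
    have ha1 : a⁻¹ ∉ H := by
      have := ha a⁻¹ (inv_mem haM)
      simp only [inv_mul_cancel, one_mem, xor_true] at this
      exact this
    have ha2 : a * a ∈ H :=
      (ha a haM).elim And.left fun h => absurd (inv_mem h.1) ha1
    have hconj (h) (hh : h ∈ H) : h (a x) = a x := by
      have h1 : a⁻¹ * h ∉ H := fun h2 => ha1 (by simpa using mul_mem h2 (inv_mem hh))
      have h3 := hx _ ((ha (a⁻¹ * h) (mul_mem (inv_mem haM) (hHM hh))).elim And.left
        fun h2 => absurd h2.1 h1)
      rw [AlgEquiv.mul_apply, AlgEquiv.mul_apply, AlgEquiv.aut_inv, AlgEquiv.symm_apply_eq] at h3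
      exact h3
    have hswap (b) (hb : b ∈ M) : (b x = x ∧ b (a x) = a x) ∨ (b x = a x ∧ b (a x) = x) := by
      rcases ha b hb with ⟨h1, h2⟩ | ⟨h1, h2⟩
      · right
        refine ⟨?_, hx _ h1⟩
        have h3 := hconj _ (mul_mem h1 (inv_mem ha2))
        have h4 : b * a * (a * a)⁻¹ * a = b := by group
        rw [← AlgEquiv.mul_apply, h4] at h3
        exact h3
      · exact Or.inl ⟨hx _ h1, hconj _ h1⟩
    have ih' := ih M (by rw [hMcard, ← hH, hn]; ring)
      fun y hy => hreal y fun g hg => hy g (hHM hg)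
    obtain ⟨p, hp, hpx⟩ := ih' (x + a x) fun b hb => by
      rcases hswap b hb with h | h <;> rw [map_add, h.1, h.2]
      rw [add_comm]
    obtain ⟨q, hq, hqx⟩ := ih' (x * a x) fun b hb => by
      rcases hswap b hb with h | h <;> rw [map_mul, h.1, h.2]
      rw [mul_comm]
    obtain ⟨r, hr⟩ := hreal x hx
    refine ⟨r, mem_Qclo_of_quadratic hp hq ?_, hr⟩
    have h1 : (r : ℂ) ^ 2 = p * r - q := by
      rw [← hpx, ← hqx, ← hr, map_add, map_mul]
      ring
    exact_mod_cast h1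

theorem mem_Qclo_of_finrank_splittingField {F : Subfield ℝ} {b : ℝ} (hb : IsIntegral F b) {k : ℕ}
    (h : Module.finrank F (minpoly F b).SplittingField = 2 ^ k) : b ∈ Qclo F := by
  have : IsGalois F (minpoly F b).SplittingField :=
    IsGalois.of_separable_splitting_field (minpoly.irreducible hb).separable
  let φ : (minpoly F b).SplittingField →ₐ[F] ℂ :=
    IsSplittingField.lift _ (minpoly F b) (IsAlgClosed.splits _)
  obtain ⟨β, hβ⟩ : ∃ β, φ β = b := by
    have h1 := IsSplittingField.adjoin_rootSet_eq_range _ (minpoly F b) φ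
    have h2 : (b : ℂ) ∈ (minpoly F b).rootSet ℂ := by
      rw [mem_rootSet_of_ne (minpoly.ne_zero hb), ← Complex.coe_algebraMap, aeval_algebraMap_apply,
        minpoly.aeval, map_zero]
    exact (h1 ▸ Algebra.subset_adjoin h2 : (b : ℂ) ∈ φ.range)
  have hcard := (IsGalois.card_aut_eq_finrank F (minpoly F b).SplittingField).trans h
  let E := IntermediateField.adjoin F {β}
  have hE {x} (hx : ∀ g ∈ E.fixingSubgroup, g x = x) : x ∈ E := by
    rw [← IsGalois.fixedField_fixingSubgroup E]
    exact (IntermediateField.mem_fixedField_iff _ _).mpr hx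
  have hdvd : Nat.card E.fixingSubgroup ∣ 2 ^ k := hcard ▸ Subgroup.card_subgroup_dvd_card _
  obtain ⟨n, hnk, hn⟩ := (Nat.dvd_prime_pow Nat.prime_two).mp hdvd
  obtain ⟨r, hr, hβr⟩ := exists_mem_Qclo_of_fixed φ hcard (k - n) E.fixingSubgroup
    (by rw [hn, ← pow_add, Nat.add_sub_cancel' hnk]) (fun x hx => by
      have h1 : E ≤ (IntermediateField.comap φ (IsScalarTower.toAlgHom F ℝ ℂ).fieldRange) :=
        IntermediateField.adjoin_simple_le_iff.mpr ⟨b, hβ.symm⟩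
      obtain ⟨r, hr⟩ := h1 (hE hx)
      exact ⟨r, hr.symm⟩) β
    (fun g hg => hg ⟨β, IntermediateField.mem_adjoin_simple_self F β⟩)
  rw [hβ] at hβr
  exact Complex.ofReal_injective hβr ▸ hr

theorem AlgEquiv.pow_two_pow_apply_eq_of_le {F Ω : Type*} [Field F] [Field Ω] [Algebra F Ω]
    {σ : Gal(Ω/F)} {x : Ω} {n m : ℕ} (hnm : n ≤ m) (hx : (σ ^ 2 ^ n) x = x) :
    (σ ^ 2 ^ m) x = x := by
  obtain ⟨k, rfl⟩ := Nat.exists_eq_add_of_le hnm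
  rw [pow_add, pow_mul]
  exact pow_mem (show σ ^ 2 ^ n ∈ MulAction.stabilizer Gal(Ω/F) x from hx) _

/-- The elements of `Ω` on which every automorphism over `F` acts with order a power of two. -/
def twoPowerSubfield (F Ω : Type*) [Field F] [Field Ω] [Algebra F Ω] : Subfield Ω where
  carrier := {x | ∀ σ : Gal(Ω/F), ∃ n, (σ ^ 2 ^ n) x = x}
  zero_mem' := fun σ => ⟨0, map_zero _⟩
  one_mem' := fun σ => ⟨0, map_one _⟩
  add_mem' := fun {x y} hx hy σ => by
    obtain ⟨n, hn⟩ := hx σ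
    obtain ⟨m, hm⟩ := hy σ
    refine ⟨max n m, ?_⟩
    rw [map_add, AlgEquiv.pow_two_pow_apply_eq_of_le (le_max_left n m) hn,
      AlgEquiv.pow_two_pow_apply_eq_of_le (le_max_right n m) hm]
  mul_mem' := fun {x y} hx hy σ => by
    obtain ⟨n, hn⟩ := hx σ
    obtain ⟨m, hm⟩ := hy σ
    refine ⟨max n m, ?_⟩
    rw [map_mul, AlgEquiv.pow_two_pow_apply_eq_of_le (le_max_left n m) hn,
      AlgEquiv.pow_two_pow_apply_eq_of_le (le_max_right n m) hm]
  neg_mem' := fun {x} hx σ => by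
    obtain ⟨n, hn⟩ := hx σ
    exact ⟨n, by rw [map_neg, hn]⟩
  inv_mem' := fun x hx σ => by
    obtain ⟨n, hn⟩ := hx σ
    exact ⟨n, by rw [map_inv₀, hn]⟩

section

variable {F Ω : Type*} [Field F] [Field Ω] [Algebra F Ω]

theorem mem_twoPowerSubfield {x : Ω} :
    x ∈ twoPowerSubfield F Ω ↔ ∀ σ : Gal(Ω/F), ∃ n, (σ ^ 2 ^ n) x = x :=
  Iff.rfl

theorem algebraMap_mem_twoPowerSubfield (x : F) :
    algebraMap F Ω x ∈ twoPowerSubfield F Ω :=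
  fun _ => ⟨0, AlgEquiv.commutes _ _⟩

theorem mem_twoPowerSubfield_of_sq_mem {x : Ω} (hx : x ^ 2 ∈ twoPowerSubfield F Ω) :
    x ∈ twoPowerSubfield F Ω := fun σ => by
  obtain ⟨n, hn⟩ := hx σ
  refine ⟨n + 1, ?_⟩
  rw [map_pow, sq_eq_sq_iff_eq_or_eq_neg] at hn
  rw [pow_succ 2 n, mul_two, pow_add, AlgEquiv.mul_apply]
  rcases hn with h | h
  · rw [h, h]
  · rw [h, map_neg, h, neg_neg]

theorem apply_mem_twoPowerSubfield {x : Ω} (hx : x ∈ twoPowerSubfield F Ω) (τ : Gal(Ω/F)) :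
    τ x ∈ twoPowerSubfield F Ω := fun σ => by
  obtain ⟨n, hn⟩ := hx (τ⁻¹ * σ * τ)
  refine ⟨n, ?_⟩
  have h1 : (τ⁻¹ * σ * τ) ^ 2 ^ n = τ⁻¹ * σ ^ 2 ^ n * τ := by
    simpa using conj_pow (a := τ⁻¹) (b := σ) (i := 2 ^ n)
  rwa [h1, AlgEquiv.mul_apply, AlgEquiv.mul_apply, AlgEquiv.aut_inv, AlgEquiv.symm_apply_eq] at hn

theorem exists_finrank_splittingField_eq_two_pow [CharZero F] [Normal F Ω] {x : Ω}
    (hx : x ∈ twoPowerSubfield F Ω) :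
    ∃ n, Module.finrank F (minpoly F x).SplittingField = 2 ^ n := by
  have h_int : IsIntegral F x := Normal.isIntegral inferInstance x
  have : IsGalois F (minpoly F x).SplittingField :=
    IsGalois.of_separable_splitting_field (minpoly.irreducible h_int).separable
  have hroots : ((minpoly F x).map (algebraMap F Ω)).Splits := Normal.splits inferInstance x
  let φ : (minpoly F x).SplittingField →ₐ[F] Ω := IsSplittingField.lift _ (minpoly F x) hroots
  let := φ.toRingHom.toAlgebra
  have : IsScalarTower F (minpoly F x).SplittingField Ω := .of_algebraMap_eq' φ.comp_algebraMap.symm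
  have hmem (y : (minpoly F x).SplittingField) : φ y ∈ twoPowerSubfield F Ω := by
    have hy : y ∈ Algebra.adjoin F ((minpoly F x).rootSet _) := by
      rw [IsSplittingField.adjoin_rootSet]
      exact Algebra.mem_top
    induction hy using Algebra.adjoin_induction with
    | mem y hy =>
      have h2 : minpoly F (φ y) = minpoly F x :=
        (minpoly.algHom_eq φ φ.injective y).trans (minpoly.eq_of_irreducible_of_monic
          (minpoly.irreducible h_int) (mem_rootSet.mp hy).2 (minpoly.monic h_int)).symm
      obtain ⟨τ, hτ⟩ := (Normal.minpoly_eq_iff_mem_orbit Ω).mp h2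
      exact hτ ▸ apply_mem_twoPowerSubfield hx τ
    | algebraMap y =>
      rw [AlgHom.commutes]
      exact algebraMap_mem_twoPowerSubfield y
    | add y z _ _ hy hz => rw [map_add]; exact add_mem hy hz
    | mul y z _ _ hy hz => rw [map_mul]; exact mul_mem hy hz
  have : Fact (Nat.Prime 2) := ⟨Nat.prime_two⟩
  rw [← IsGalois.card_aut_eq_finrank, ← IsPGroup.iff_card]
  intro σ
  obtain ⟨α, hα⟩ := Field.exists_primitive_element F (minpoly F x).SplittingField
  obtain ⟨n, hn⟩ := hmem α (σ.liftNormal Ω)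
  refine ⟨n, ?_⟩
  have hlift (m : ℕ) : ((σ.liftNormal Ω) ^ m) (φ α) = φ ((σ ^ m) α) := by
    induction m with
    | zero => rfl
    | succ m ih =>
      rw [pow_succ', pow_succ', AlgEquiv.mul_apply, AlgEquiv.mul_apply, ih]
      exact σ.liftNormal_commutes Ω _
  rw [hlift] at hn
  have h1 := φ.injective hn
  refine AlgEquiv.ext fun y => ?_
  have hy : y ∈ IntermediateField.adjoin F {α} := hα ▸ IntermediateField.mem_top
  have hle : IntermediateField.adjoin F {α} ≤
      IntermediateField.fixedField (Subgroup.zpowers (σ ^ 2 ^ n)) :=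
    IntermediateField.adjoin_simple_le_iff.mpr <|
      (IntermediateField.mem_fixedField_iff _ _).mpr fun f hf => Subgroup.zpowers_le.mpr
        (show σ ^ 2 ^ n ∈ MulAction.stabilizer Gal((minpoly F x).SplittingField/F) α from h1) hf
  exact (IntermediateField.mem_fixedField_iff _ _).mp (hle hy) _ (Subgroup.mem_zpowers _)

end

theorem exists_finrank_splittingField_minpoly_eq_two_pow {F : Subfield ℝ} {b : ℝ}
    (hb : b ∈ Qclo F) : IsIntegral F b ∧
      ∃ n, Module.finrank F (minpoly F b).SplittingField = 2 ^ n := by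
  let Ω := algebraicClosure F ℂ
  have hclo : Qclo F ≤ ((twoPowerSubfield F Ω).map (algebraMap Ω ℂ)).comap (algebraMap ℝ ℂ) := by
    refine Qclo_le (fun x hx => ?_) fun c hc h0 => ?_
    · exact ⟨_, algebraMap_mem_twoPowerSubfield ⟨x, hx⟩, rfl⟩
    · obtain ⟨y, hy, hyc⟩ := hc
      have h1 : ((√c : ℝ) : ℂ) ^ 2 = y := by
        rw [← Complex.ofReal_pow, Real.sq_sqrt h0]
        exact hyc.symm
      have h2 : ((√c : ℝ) : ℂ) ∈ Ω := by
        rw [mem_algebraicClosure_iff]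
        refine IsAlgebraic.of_pow two_pos ?_
        rw [h1]
        exact mem_algebraicClosure_iff.mp y.2
      have h3 : (⟨_, h2⟩ : Ω) ^ 2 = y := Subtype.ext h1
      exact ⟨⟨_, h2⟩, mem_twoPowerSubfield_of_sq_mem (h3 ▸ hy), rfl⟩
  obtain ⟨y, hy, hyb⟩ := hclo hb
  have h1 : minpoly F y = minpoly F b := by
    rw [← minpoly.algebraMap_eq (algebraMap Ω ℂ).injective, hyb,
      minpoly.algebraMap_eq (algebraMap ℝ ℂ).injective]
  have hN : Normal F Ω := IsGalois.to_normal
  refine ⟨?_, ?_⟩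
  · have h2 : IsIntegral F y := Normal.isIntegral hN y
    have h3 := h2.algebraMap (B := ℂ)
    rw [hyb] at h3
    exact (isIntegral_algebraMap_iff (algebraMap ℝ ℂ).injective).mp h3
  · rw [← h1]
    exact exists_finrank_splittingField_eq_two_pow hy

end QuadraticClosure

section RationalParameter

open Polynomial

theorem closure_coe_preimage_eq_top (s : Set ℝ) :
    Subfield.closure ((↑) ⁻¹' s : Set (Subfield.closure s)) = ⊤ := by
  rw [eq_top_iff]
  rintro ⟨x, hx⟩ -
  have h : Subfield.closure s ≤ (Subfield.closure ((↑) ⁻¹' s : Set (Subfield.closure s))).map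
      (Subfield.closure s).subtype :=
    Subfield.closure_le.mpr fun y hy =>
      ⟨⟨y, Subfield.subset_closure hy⟩, Subfield.subset_closure hy, rfl⟩
  obtain ⟨y, hy, hyx⟩ := h hx
  exact (Subtype.ext hyx : y = ⟨x, hx⟩) ▸ hy

theorem eval₂_mem_closure_insert {s : Set ℝ} (x : ℝ) (p : (Subfield.closure s)[X]) :
    eval₂ (algebraMap _ ℝ) x p ∈ Subfield.closure (insert x s) := by
  rw [eval₂_eq_sum_range]
  exact sum_mem fun i _ =>
    mul_mem (Subfield.closure_mono (Set.subset_insert x s) (p.coeff i).2)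
      (pow_mem (Subfield.subset_closure (Set.mem_insert x s)) i)

theorem isFractionRing_closure_insert {s : Set ℝ} {c : ℝ}
    [Algebra (Subfield.closure s)[X] (Subfield.closure (insert c s))]
    (hc : Transcendental (Subfield.closure s) c)
    (h : ∀ p : (Subfield.closure s)[X],
      (algebraMap _ (Subfield.closure (insert c s)) p : ℝ) = aeval c p) :
    IsFractionRing (Subfield.closure s)[X] (Subfield.closure (insert c s)) := by
  have : FaithfulSMul (Subfield.closure s)[X] (Subfield.closure (insert c s)) := by
    rw [faithfulSMul_iff_algebraMap_injective]
    intro p q hpq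
    exact transcendental_iff_injective.mp hc (by rw [← h, ← h, hpq])
  refine IsFractionRing.of_field _ _ fun z => ?_
  have hle : Subring.closure (insert c s) ≤
      (aeval c : (Subfield.closure s)[X] →ₐ[_] ℝ).toRingHom.range := by
    refine Subring.closure_le.mpr (Set.insert_subset ⟨X, aeval_X c⟩ fun y hy => ?_)
    exact ⟨C ⟨y, Subfield.subset_closure hy⟩, aeval_C _ _⟩
  obtain ⟨x, hx, y, hy, hxy⟩ := Subfield.mem_closure_iff.mp z.2
  obtain ⟨p, rfl⟩ := hle hx
  obtain ⟨q, rfl⟩ := hle hy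
  refine ⟨p, q, Subtype.ext ?_⟩
  rw [← hxy]
  push_cast
  rw [h, h]
  rfl

theorem continuousOn_eval₂_eval₂RingHom {K : Subfield ℝ} {I : Set ℝ} {v : ℝ → ℝ}
    (hv : ContinuousOn v I) (P : K[X][X]) :
    ContinuousOn (fun x => P.eval₂ (eval₂RingHom (algebraMap K ℝ) x) (v x)) I := by
  simp only [eval₂_eq_sum_range, coe_eval₂RingHom]
  fun_prop

theorem exists_rat_notMem_Qclo_of_monic {s : Set ℝ} (hs : s.Finite) {I : Set ℝ} (hI : IsOpen I)
    {v : ℝ → ℝ} (hv : ContinuousOn v I) {W : (Subfield.closure s)[X][X]} (hW : W.Monic)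
    (hWv : ∀ x ∈ I, W.eval₂ (eval₂RingHom (algebraMap _ ℝ) x) (v x) = 0)
    {c : ℝ} (hcI : c ∈ I) (hc : Transcendental (Subfield.closure s) c)
    (hnc : v c ∉ Qclo (Subfield.closure (insert c s))) :
    ∃ q : ℚ, (q : ℝ) ∈ I ∧ v q ∉ Qclo (Subfield.closure s) := by
  let : Algebra (Subfield.closure s)[X] ℝ := (eval₂RingHom (algebraMap _ ℝ) c).toAlgebra
  let : Algebra (Subfield.closure s)[X] (Subfield.closure (insert c s)) :=
    ((algebraMap (Subfield.closure s)[X] ℝ).codRestrict _ (eval₂_mem_closure_insert c)).toAlgebra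
  have : IsScalarTower (Subfield.closure s)[X] (Subfield.closure (insert c s)) ℝ :=
    .of_algebraMap_eq fun _ => rfl
  have : IsFractionRing (Subfield.closure s)[X] (Subfield.closure (insert c s)) :=
    isFractionRing_closure_insert hc fun p => rfl
  have : FaithfulSMul (Subfield.closure s)[X] ℝ :=
    (faithfulSMul_iff_algebraMap_injective _ _).mpr (transcendental_iff_injective.mp hc)
  have h_int : IsIntegral (Subfield.closure s)[X] (v c) := ⟨W, hW, hWv c hcI⟩
  set P := minpoly (Subfield.closure s)[X] (v c) with hPdef
  have hP : P.Monic := minpoly.monic h_int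
  have hPirr : Irreducible P := minpoly.irreducible h_int
  obtain ⟨R, hWR, hPR⟩ := (FiniteMultiplicity.of_not_isUnit hPirr.not_isUnit
    hW.ne_zero).exists_eq_pow_mul_and_not_dvd
  have hRc : R.eval₂ (eval₂RingHom (algebraMap _ ℝ) c) (v c) ≠ 0 := fun h =>
    hPR (minpoly.isIntegrallyClosed_dvd h_int h)
  have hJ := (continuousOn_eval₂_eval₂RingHom hv R).isOpen_inter_preimage hI
    (isOpen_ne (x := (0 : ℝ)))
  obtain ⟨q, ⟨hqI, hqR⟩, hqirr, hdvd⟩ := exists_rat_irreducible_and_finrank_splittingField_dvd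
    (F := Subfield.closure (insert c s)) (hs.preimage Subtype.val_injective.injOn)
    (closure_coe_preimage_eq_top s) hJ ⟨c, hcI, hRc⟩ hP hPirr
  refine ⟨q, hqI, fun hq => hnc ?_⟩
  obtain ⟨hqint, n, hn⟩ := exists_finrank_splittingField_minpoly_eq_two_pow hq
  have hroot : aeval (v q) (P.map (evalRingHom (q : Subfield.closure s))) = 0 := by
    have h1 := hWv q hqI
    rw [hWR, eval₂_mul, eval₂_pow] at h1
    have h2 := eq_zero_of_pow_eq_zero ((mul_eq_zero.mp h1).resolve_right hqR)
    rw [aeval_def, eval₂_map, ← h2]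
    congr 1
    ext <;> simp
  rw [minpoly.eq_of_irreducible_of_monic hqirr hroot (hP.map _), hn] at hdvd
  obtain ⟨m, -, hm⟩ := (Nat.dvd_prime_pow Nat.prime_two).mp hdvd
  rw [hPdef, ← minpoly.isIntegrallyClosed_eq_field_fractions _ ℝ h_int] at hm
  exact mem_Qclo_of_finrank_splittingField h_int.tower_top hm

theorem closure_insert_ratCast (s : Set ℝ) (q : ℚ) :
    Subfield.closure (insert (q : ℝ) s) = Subfield.closure s :=
  le_antisymm
    (Subfield.closure_le.mpr (Set.insert_subset (SubfieldClass.ratCast_mem _ q)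
      Subfield.subset_closure))
    (Subfield.closure_mono (Set.subset_insert _ s))

theorem exists_rat_notMem_Qclo {s : Set ℝ} (hs : s.Finite) {I : Set ℝ} (hI : IsOpen I)
    {u : ℝ → ℝ} (hu : ContinuousOn u I) {W : (Subfield.closure s)[X][X]} (hW : W ≠ 0)
    (hWu : ∀ x ∈ I, W.eval₂ (eval₂RingHom (algebraMap _ ℝ) x) (u x) = 0)
    {c : ℝ} (hcI : c ∈ I) (hc : Transcendental (Subfield.closure s) c)
    (hnc : u c ∉ Qclo (Subfield.closure (insert c s))) :
    ∃ q : ℚ, (q : ℝ) ∈ I ∧ u q ∉ Qclo (Subfield.closure s) := by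
  have hev {p : (Subfield.closure s)[X]} (hp : p ≠ 0) : eval₂ (algebraMap _ ℝ) c p ≠ 0 :=
    fun h => hp (transcendental_iff.mp hc p h)
  have hdeg : 1 ≤ W.natDegree := by
    by_contra! h
    rw [Nat.lt_one_iff] at h
    rw [eq_C_of_natDegree_eq_zero h] at hW hWu
    have h1 := hWu c hcI
    rw [eval₂_C] at h1
    exact hev (fun h => hW (by rw [h, C_0])) h1
  let v (x : ℝ) := eval₂RingHom (algebraMap _ ℝ) x W.leadingCoeff * u x
  have hmem (x : ℝ) : eval₂RingHom (algebraMap _ ℝ) x W.leadingCoeff ∈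
      Qclo (Subfield.closure (insert x s)) :=
    le_Qclo _ (eval₂_mem_closure_insert x W.leadingCoeff)
  have hD := hev (leadingCoeff_ne_zero.mpr hW)
  have hv : ContinuousOn v I := by
    refine ContinuousOn.mul ?_ hu
    simpa using continuousOn_eval₂_eval₂RingHom hu (C W.leadingCoeff)
  obtain ⟨q, hq, hvq⟩ := exists_rat_notMem_Qclo_of_monic hs hI hv
    (monic_integralNormalization hW) (fun x hx => by
      rw [integralNormalization_eval₂_leadingCoeff_mul hdeg, hWu x hx, mul_zero]) hcI hc
    (fun h => hnc ((mul_div_cancel_left₀ (u c) hD) ▸ div_mem h (hmem c)))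
  refine ⟨q, hq, fun h => hvq (mul_mem ?_ h)⟩
  simpa only [closure_insert_ratCast] using hmem q

theorem exists_polynomial_eval₂_eq_eval {K : Subfield ℝ} {W : MvPolynomial (Fin 2) ℝ} (hW : W ≠ 0)
    (hWc : ∀ d, W.coeff d ∈ K) :
    ∃ w : K[X][X], w ≠ 0 ∧ ∀ x y : ℝ,
      w.eval₂ (eval₂RingHom (algebraMap K ℝ) x) y = MvPolynomial.eval ![x, y] W := by
  obtain ⟨W, rfl⟩ := (MvPolynomial.mem_range_map_iff_coeffs_subset (f := algebraMap K ℝ)).mpr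
    (show (W.coeffs : Set ℝ) ⊆ _ by
      intro z hz
      obtain ⟨d, -, rfl⟩ := MvPolynomial.mem_coeffs_iff.mp hz
      exact ⟨⟨_, hWc d⟩, rfl⟩)
  refine ⟨MvPolynomial.aeval ![C X, X] W, fun h => hW ?_, fun x y => ?_⟩
  · have key : (eval₂RingHom (eval₂RingHom MvPolynomial.C (MvPolynomial.X 0))
        (MvPolynomial.X 1)).comp (MvPolynomial.aeval ![C X, X] : _ →ₐ[K] K[X][X]).toRingHom =
        RingHom.id (MvPolynomial (Fin 2) K) := by
      refine MvPolynomial.ringHom_ext (fun r => ?_) fun i => ?_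
      · simp [Polynomial.algebraMap_apply]
      · fin_cases i <;> simp
    have hW0 : W = 0 := by
      rw [← RingHom.id_apply W, ← key]
      exact (congrArg _ h).trans (eval₂_zero _ _)
    rw [hW0, map_zero]
  · have key : (eval₂RingHom (eval₂RingHom (algebraMap K ℝ) x) y).comp
        (MvPolynomial.aeval ![C X, X] : _ →ₐ[K] K[X][X]).toRingHom =
        (MvPolynomial.eval ![x, y]).comp (MvPolynomial.map (algebraMap K ℝ)) := by
      refine MvPolynomial.ringHom_ext (fun r => ?_) fun i => ?_
      · simp [Polynomial.algebraMap_apply]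
      · fin_cases i <;> simp
    exact DFunLike.congr_fun key W

theorem TranscOver.transcendental {K : Subfield ℝ} {c : ℝ} (hc : TranscOver K c) :
    Transcendental K c := by
  refine transcendental_iff.mpr fun p hp => ?_
  refine (Polynomial.map_eq_zero (algebraMap K ℝ)).mp (hc _ (fun i => ?_) ?_)
  · rw [coeff_map]
    exact (p.coeff i).2
  · rwa [eval_map_algebraMap]

end RationalParameter

/-- Rational Parameter Theorem for geometric constructibility.  Let `I` be a nonempty
open interval (a nonempty open order-connected subset of `ℝ`), `u` continuous on `I`,
and `W` a nonzero two-variable polynomial with coefficients in `K = ℚ(a₁,…,aₘ)` such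
that `W(x, u x) = 0` on `I`.  If some `c ∈ I` transcendental over `K` has `u c` not
constructible from `a₁,…,aₘ,c`, then some rational `c' ∈ I` has `u c'` not
constructible from `a₁,…,aₘ,c'`. -/
theorem statement16 (I : Set ℝ) (hne : I.Nonempty) (hop : IsOpen I)
    (hconn : I.OrdConnected)
    (m : ℕ) (a : Fin m → ℝ) (u : ℝ → ℝ) (hu : ContinuousOn u I)
    (W : MvPolynomial (Fin 2) ℝ) (hW0 : W ≠ 0)
    (hWc : ∀ mo : Fin 2 →₀ ℕ, MvPolynomial.coeff mo W ∈ Subfield.closure (Set.range a))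
    (hWu : ∀ x ∈ I, MvPolynomial.eval ![x, u x] W = 0)
    (c : ℝ) (hc : c ∈ I) (hct : TranscOver (Subfield.closure (Set.range a)) c)
    (hnc : u c ∉ Qclo (Subfield.closure (insert c (Set.range a)))) :
    ∃ c' : ℚ, (c' : ℝ) ∈ I ∧
      u (c' : ℝ) ∉ Qclo (Subfield.closure (insert ((c' : ℝ)) (Set.range a))) := by
  obtain ⟨w, hw, hwW⟩ := exists_polynomial_eval₂_eq_eval hW0 hWc
  simp_rw [closure_insert_ratCast]
  exact exists_rat_notMem_Qclo (Set.finite_range a) hop hu hw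
    (fun x hx => (hwW x (u x)).trans (hWu x hx)) hc hct.transcendental hnc
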